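/- arXiv:1102.4588 — 5 statements merged into one kernel-verified Lean document; each statement's English description precedes it below -/
import Mathlib

section
/- Proposition (Kabaya's criterion). Suppose the subgroup Λ ⊆ ℤ^(2n+1) has rank n−1 and its image under the projection (a₁,…,aₙ,b₁,…,bₙ,c) ↦ (a₁,…,aₙ) ∈ ℤⁿ also has rank n−1. Then every totally positive degeneration vector d (i.e., one with dᵢ > 0 for all i) is genuine. -/
open scoped BigOperators

/-- The ambient lattice `ℤ^(2n+1)`, with elements written `(a, b, c)`. -/
abbrev GlueVec (n : ℕ) := (Fin n → ℤ) × (Fin n → ℤ) × ℤ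

/-- The variety of gluing equation type `V(Λ)`: points `z ∈ (ℂ∖{0,1})^n` with
`∏ zᵢ^{aᵢ} · ∏ (1-zᵢ)^{bᵢ} = (-1)^c` for all `(a,b,c) ∈ Λ`. -/
def glueVariety (n : ℕ) (Λ : Submodule ℤ (GlueVec n)) : Set (Fin n → ℂ) :=
  {z | (∀ i, z i ≠ 0 ∧ z i ≠ 1) ∧
    ∀ v ∈ Λ, (∏ i, z i ^ v.1 i) * (∏ i, (1 - z i) ^ v.2.1 i) = (-1 : ℂ) ^ v.2.2}

/-- `d` is a degeneration vector for `Λ`: nonzero, nonnegative (automatic as `d : Fin n → ℕ`),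
with `∑ aᵢ dᵢ = 0` for all `(a,b,c) ∈ Λ`. -/
def IsDegVec (n : ℕ) (Λ : Submodule ℤ (GlueVec n)) (d : Fin n → ℕ) : Prop :=
  d ≠ 0 ∧ ∀ v ∈ Λ, ∑ i, v.1 i * (d i : ℤ) = 0

/-- `d` is genuine: there are holomorphic functions `uᵢ` on a disc of radius `ε` about `0`,
with `uᵢ(0) ≠ 0`, and `uᵢ(0) ≠ 1` whenever `dᵢ = 0`, such that
`(t^{d₁}u₁(t), …, t^{dₙ}uₙ(t)) ∈ V(Λ)` for all `0 < |t| < ε`. -/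
def IsGenuine (n : ℕ) (Λ : Submodule ℤ (GlueVec n)) (d : Fin n → ℕ) : Prop :=
  ∃ ε : ℝ, 0 < ε ∧ ∃ u : Fin n → (ℂ → ℂ),
    (∀ i, DifferentiableOn ℂ (u i) (Metric.ball (0 : ℂ) ε)) ∧
    (∀ i, u i 0 ≠ 0) ∧
    (∀ i, d i = 0 → u i 0 ≠ 1) ∧
    ∀ t : ℂ, 0 < ‖t‖ → ‖t‖ < ε → (fun i => t ^ (d i) * u i t) ∈ glueVariety n Λ

/-- The set `Ū = {(t,u) ∈ ℂ × (ℂ∖{0})^n : t^{dᵢ} uᵢ ≠ 1 for all i}`. -/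
def Ubar (n : ℕ) (d : Fin n → ℕ) : Set (ℂ × (Fin n → ℂ)) :=
  {p | (∀ i, p.2 i ≠ 0) ∧ ∀ i, p.1 ^ (d i) * p.2 i ≠ 1}

/-- The set `W(Λ,d) = {(t,u) ∈ Ū : t ≠ 0 and (t^{d₁}u₁, …, t^{dₙ}uₙ) ∈ V(Λ)}`. -/
def Wset (n : ℕ) (Λ : Submodule ℤ (GlueVec n)) (d : Fin n → ℕ) : Set (ℂ × (Fin n → ℂ)) :=
  {p ∈ Ubar n d | p.1 ≠ 0 ∧ (fun i => p.1 ^ (d i) * p.2 i) ∈ glueVariety n Λ}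

/-- `W̄(Λ,d)`, the closure of `W(Λ,d)` in `Ū` (with the subspace topology, i.e. the
intersection of the ambient closure with `Ū`). -/
def Wbar (n : ℕ) (Λ : Submodule ℤ (GlueVec n)) (d : Fin n → ℕ) : Set (ℂ × (Fin n → ℂ)) :=
  closure (Wset n Λ d) ∩ Ubar n d

/-- `W̄₀(Λ,d) = W̄(Λ,d) ∩ {t = 0}`. -/
def WbarZero (n : ℕ) (Λ : Submodule ℤ (GlueVec n)) (d : Fin n → ℕ) : Set (ℂ × (Fin n → ℂ)) :=
  Wbar n Λ d ∩ {p | p.1 = 0}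

open Filter Topology

/-- A map `Φ` that is `C¹` at `(0, w₀)` and constantly `w₀` on the slice `{0} × E` has a `C¹`
family of fixed points `ψ t = Φ (t, ψ t)` through `ψ 0 = w₀`. -/
theorem ContDiffAt.exists_eventually_fixedPoint {E : Type*} [NormedAddCommGroup E]
    [NormedSpace ℂ E] [CompleteSpace E] {Φ : ℂ × E → E} {w₀ : E}
    (hΦ : ContDiffAt ℂ 1 Φ (0, w₀)) (h₀ : ∀ w, Φ (0, w) = w₀) :
    ∃ ψ : ℂ → E, ContDiffAt ℂ 1 ψ 0 ∧ ∀ᶠ t in 𝓝 0, ψ t = Φ (t, ψ t) := by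
  have hF : ContDiffAt ℂ 1 (fun p : ℂ × E => p.2 - Φ p) (0, w₀) := contDiffAt_snd.sub hΦ
  have hcomp : HasFDerivAt (fun w : E => w - Φ (0, w))
      (fderiv ℂ (fun p : ℂ × E => p.2 - Φ p) (0, w₀) ∘L .inr ℂ ℂ E) w₀ :=
    (hF.differentiableAt one_ne_zero).hasFDerivAt.comp w₀ (hasFDerivAt_prodMk_right 0 w₀)
  have hid : HasFDerivAt (fun w : E => w - Φ (0, w)) (.id ℂ E) w₀ := by
    simpa only [h₀, id] using (hasFDerivAt_id w₀).sub_const w₀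
  have hinv : (fderiv ℂ (fun p : ℂ × E => p.2 - Φ p) (0, w₀) ∘L .inr ℂ ℂ E).IsInvertible :=
    ⟨.refl ℂ E, (hcomp.unique hid).symm⟩
  refine ⟨hF.implicitFunction one_ne_zero hinv,
    hF.contDiffAt_implicitFunction one_ne_zero hinv, ?_⟩
  filter_upwards [hF.eventually_apply_implicitFunction one_ne_zero hinv] with t ht
  simpa [h₀, sub_eq_zero] using ht

/-- If the projection `(a, b, c) ↦ a` preserves the rank of `Λ`, every additive functional on the
ambient lattice agrees on `Λ` with a complex linear combination of the coordinates of `a`. -/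
theorem exists_coeff_of_finrank_map_fst {n : ℕ} {Λ : Submodule ℤ (GlueVec n)}
    (h : Module.finrank ℤ Λ ≤ Module.finrank ℤ
      (Λ.map (LinearMap.fst ℤ (Fin n → ℤ) ((Fin n → ℤ) × ℤ))))
    (φ : GlueVec n →ₗ[ℤ] ℂ) : ∃ q : Fin n → ℂ, ∀ v ∈ Λ, ∑ j, (v.1 j : ℂ) * q j = φ v := by
  have hinj := LinearMap.injective_domRestrict_iff.mpr
    (Submodule.disjoint_ker_of_finrank_le _ h)
  obtain ⟨g, hg⟩ := (Module.Baer.of_divisible ℂ).extension_property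
    ((LinearMap.fst ℤ (Fin n → ℤ) ((Fin n → ℤ) × ℤ)).domRestrict Λ) hinj (φ.domRestrict Λ)
  refine ⟨fun j => g fun i => if j = i then 1 else 0, fun v hv => ?_⟩
  have hgv : g v.1 = φ v := LinearMap.congr_fun hg ⟨v, hv⟩
  simp only [← hgv, LinearMap.pi_apply_eq_sum_univ g v.1, zsmul_eq_mul]

/-- A point with coordinates `zᵢ = t ^ dᵢ * exp wᵢ ≠ 1` satisfies the gluing equation of `(a, b, c)`
as soon as its logarithmic form holds and `d` is orthogonal to `a`. -/
theorem gluing_equation_of_log {n : ℕ} {d : Fin n → ℕ} {v : GlueVec n} {t : ℂ} {w : Fin n → ℂ}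
    (ht : t ≠ 0) (hd : ∑ i, v.1 i * (d i : ℤ) = 0)
    (h1 : ∀ i, t ^ d i * Complex.exp (w i) ≠ 1)
    (hw : ∑ i, (v.1 i : ℂ) * w i = v.2.2 * (Real.pi * Complex.I)
      - ∑ i, (v.2.1 i : ℂ) * Complex.log (1 - t ^ d i * Complex.exp (w i))) :
    (∏ i, (t ^ d i * Complex.exp (w i)) ^ v.1 i) *
      (∏ i, (1 - t ^ d i * Complex.exp (w i)) ^ v.2.1 i) = (-1 : ℂ) ^ v.2.2 := by
  have hpow : ∏ i, (t ^ d i) ^ v.1 i = 1 := by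
    have hsum : ∑ i, (v.1 i : ℂ) * (d i * Complex.log t) = 0 := by
      simp_rw [← mul_assoc, ← Finset.sum_mul]
      rw [show ∑ i, (v.1 i : ℂ) * d i = 0 by exact_mod_cast hd, zero_mul]
    rw [← Complex.exp_zero, ← hsum, Complex.exp_sum]
    simp_rw [Complex.exp_int_mul, Complex.exp_nat_mul, Complex.exp_log ht]
  have hlog : ∀ i, (1 - t ^ d i * Complex.exp (w i)) ^ v.2.1 i =
      Complex.exp (v.2.1 i * Complex.log (1 - t ^ d i * Complex.exp (w i))) := fun i => by
    rw [Complex.exp_int_mul, Complex.exp_log (sub_ne_zero.mpr (h1 i).symm)]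
  simp_rw [mul_zpow, Finset.prod_mul_distrib, hpow, hlog, ← Complex.exp_int_mul,
    ← Complex.exp_sum, one_mul]
  rw [← Complex.exp_add, hw, sub_add_cancel, Complex.exp_int_mul, Complex.exp_pi_mul_I]

/-- **Kabaya's criterion** (Proposition 4.3). If `Λ` has rank `n-1` and its image under
`(a,b,c) ↦ a` also has rank `n-1`, then every totally positive degeneration vector is
genuine. -/
theorem kabaya_criterion (n : ℕ) (hn : 1 ≤ n) (Λ : Submodule ℤ (GlueVec n))
    (hΛrank : Module.finrank ℤ Λ = n - 1)
    (hArank : Module.finrank ℤ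
      (Λ.map (LinearMap.fst ℤ (Fin n → ℤ) ((Fin n → ℤ) × ℤ))) = n - 1)
    (d : Fin n → ℕ) (hd : IsDegVec n Λ d) (hpos : ∀ i, 0 < d i) :
    IsGenuine n Λ d := by
  have hrank := (hΛrank.trans hArank.symm).le
  obtain ⟨γ, hγ⟩ := exists_coeff_of_finrank_map_fst hrank
    ((Algebra.linearMap ℤ ℂ) ∘ₗ LinearMap.snd ℤ _ _ ∘ₗ LinearMap.snd ℤ _ _)
  choose M hM using fun i : Fin n => exists_coeff_of_finrank_map_fst hrank
    ((Algebra.linearMap ℤ ℂ) ∘ₗ LinearMap.proj i ∘ₗ LinearMap.fst ℤ _ _ ∘ₗ LinearMap.snd ℤ _ _)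
  simp only [LinearMap.comp_apply, LinearMap.snd_apply, LinearMap.fst_apply, LinearMap.proj_apply,
    Algebra.linearMap_apply, eq_intCast] at hγ hM
  have hd0 : ∀ i, d i ≠ 0 := fun i => (hpos i).ne'
  let Φ : ℂ × (Fin n → ℂ) → Fin n → ℂ := fun p j => γ j * (Real.pi * Complex.I) -
    ∑ i, M i j * Complex.log (1 - p.1 ^ d i * Complex.exp (p.2 i))
  obtain ⟨ψ, hψ, hfix⟩ := ContDiffAt.exists_eventually_fixedPoint (Φ := Φ)
    (w₀ := fun j => γ j * (Real.pi * Complex.I))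
    (by
      refine contDiffAt_pi.mpr fun j => contDiffAt_const.sub <| ContDiffAt.sum fun i _ =>
        contDiffAt_const.mul <| ContDiffAt.comp _
          (Complex.contDiffAt_log (by simp [hd0])) ?_
      fun_prop)
    (fun w => by simp [Φ, hd0])
  have hne : ∀ᶠ t in 𝓝 (0 : ℂ), ∀ i, t ^ d i * Complex.exp (ψ t i) ≠ 1 := by
    refine eventually_all.mpr fun i => ContinuousAt.eventually_ne ?_ (by simp [hd0])
    have := (continuousAt_pi.mp hψ.continuousAt i).cexp
    fun_prop
  obtain ⟨ε, hε, hball⟩ := Metric.eventually_nhds_iff_ball.mp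
    ((hψ.eventually (by simp)).and (hfix.and hne))
  refine ⟨ε, hε, fun i t => Complex.exp (ψ t i), fun i t ht => ?_, fun i => Complex.exp_ne_zero _,
    fun i hi => absurd hi (hd0 i), fun t ht0 htε => ?_⟩
  · have := (hball t ht).1.differentiableAt one_ne_zero
    exact ((differentiableAt_pi.mp this i).cexp).differentiableWithinAt
  · obtain ⟨-, hfixt, hnet⟩ := hball t (mem_ball_zero_iff.mpr htε)
    have ht : t ≠ 0 := norm_pos_iff.mp ht0
    refine ⟨fun i => ⟨mul_ne_zero (pow_ne_zero _ ht) (Complex.exp_ne_zero _), hnet i⟩,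
      fun v hv => gluing_equation_of_log ht (hd.2 v hv) hnet ?_⟩
    calc ∑ j, (v.1 j : ℂ) * ψ t j
        = ∑ j, (v.1 j : ℂ) * Φ (t, ψ t) j := by rw [← hfixt]
      _ = (∑ j, (v.1 j : ℂ) * γ j) * (Real.pi * Complex.I) - ∑ i, (∑ j, (v.1 j : ℂ) * M i j) *
            Complex.log (1 - t ^ d i * Complex.exp (ψ t i)) := by
          simp only [Φ, mul_sub, Finset.sum_sub_distrib, Finset.sum_mul, Finset.mul_sum, mul_assoc]
          rw [Finset.sum_comm (f := fun j i => _)]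
      _ = _ := by simp only [hγ v hv, hM _ v hv]
end

section
/- If the set W̄₀(Λ,d) is nonempty for a degeneration vector d for Λ, then there is a positive integer m such that the degeneration vector m·d is genuine. -/
open scoped BigOperators

/-- The filter of neighbourhoods of `i∞` in the complex plane. -/
abbrev imInfty : Filter ℂ := Filter.comap Complex.im Filter.atTop

instance imInfty_neBot : Filter.NeBot imInfty :=
  Filter.comap_neBot_iff.mpr fun s hs => by
    obtain ⟨x, hx⟩ := Filter.nonempty_of_mem hs
    exact ⟨⟨0, x⟩, hx⟩

theorem eventually_imInfty {p : ℂ → Prop} :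
    (∀ᶠ z in imInfty, p z) ↔ ∃ R : ℝ, ∀ z : ℂ, R < z.im → p z := by
  simp [((Filter.atTop_basis_Ioi (α := ℝ)).comap Complex.im).eventually_iff]

theorem eventually_imInfty_add_nat {p : ℂ → Prop} (h : ∀ᶠ z in imInfty, p z) :
    ∀ᶠ z in imInfty, ∀ k : ℕ, p (z + k) := by
  obtain ⟨R, hR⟩ := eventually_imInfty.mp h
  exact eventually_imInfty.mpr ⟨R, fun z hz k => hR _ (by simpa using hz)⟩

theorem qParam_mul_pow {k : ℕ} (hk : 0 < k) (M : ℕ) (z : ℂ) :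
    Function.Periodic.qParam (k * M : ℕ) z ^ k = Function.Periodic.qParam M z := by
  have hk' : (k : ℂ) ≠ 0 := by exact_mod_cast hk.ne'
  rw [Function.Periodic.qParam, Function.Periodic.qParam, ← Complex.exp_nat_mul]
  congr 1
  push_cast
  rw [mul_div_assoc', mul_div_mul_left _ _ hk']

theorem qParam_add_nat {M : ℕ} (hM : 0 < M) (k : ℕ) (z : ℂ) :
    Function.Periodic.qParam M (z + (k * M : ℕ)) = Function.Periodic.qParam M z := by
  have hM' : (M : ℂ) ≠ 0 := by exact_mod_cast hM.ne'
  rw [Function.Periodic.qParam, Function.Periodic.qParam, Complex.exp_eq_exp_iff_exists_int]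
  refine ⟨k, ?_⟩
  push_cast
  field_simp

theorem eventually_qParam_iff {M : ℕ} (hM : 0 < M) {p : ℂ → Prop} :
    (∀ᶠ z in imInfty, p (Function.Periodic.qParam M z)) ↔ ∀ᶠ s in nhdsWithin 0 {0}ᶜ, p s := by
  have hM' : (0 : ℝ) < M := by exact_mod_cast hM
  refine ⟨fun h => ?_, fun h => (Function.Periodic.qParam_tendsto hM').eventually h⟩
  filter_upwards [(Function.Periodic.invQParam_tendsto hM').eventually h, self_mem_nhdsWithin]
    with s hs hs0
  rwa [Function.Periodic.qParam_right_inv hM'.ne' hs0] at hs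

/-- `f` is near `i∞` a meromorphic function of `exp (2πiz / M)`. -/
def IsPuiseuxWith (M : ℕ) (f : ℂ → ℂ) : Prop :=
  ∃ G : ℂ → ℂ, MeromorphicAt G 0 ∧ ∀ᶠ z in imInfty, f z = G (Function.Periodic.qParam M z)

namespace IsPuiseuxWith

variable {M : ℕ} {f g : ℂ → ℂ}

theorem congr (hf : IsPuiseuxWith M f) (h : ∀ᶠ z in imInfty, g z = f z) : IsPuiseuxWith M g := by
  obtain ⟨G, hG, hfG⟩ := hf
  exact ⟨G, hG, by filter_upwards [h, hfG] with z h1 h2 using h1.trans h2⟩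

theorem mul_left (hf : IsPuiseuxWith M f) {k : ℕ} (hk : 0 < k) : IsPuiseuxWith (k * M) f := by
  obtain ⟨G, hG, hfG⟩ := hf
  refine ⟨fun s => G (s ^ k), ?_, ?_⟩
  · exact MeromorphicAt.comp_analyticAt (g := fun s : ℂ => s ^ k)
      (by simpa [hk.ne'] using hG) (by fun_prop)
  · filter_upwards [hfG] with z hz
    rw [hz, qParam_mul_pow hk]

theorem of_dvd (hf : IsPuiseuxWith M f) {M' : ℕ} (hM' : 0 < M') (h : M ∣ M') :
    IsPuiseuxWith M' f := by
  obtain ⟨k, rfl⟩ := h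
  rw [mul_comm]
  exact hf.mul_left (Nat.pos_of_mul_pos_left hM')

theorem add (hf : IsPuiseuxWith M f) (hg : IsPuiseuxWith M g) :
    IsPuiseuxWith M fun z => f z + g z := by
  obtain ⟨F, hF, hfF⟩ := hf
  obtain ⟨G, hG, hgG⟩ := hg
  exact ⟨F + G, hF.add hG, by filter_upwards [hfF, hgG] with z h1 h2; simp [h1, h2]⟩

theorem mul (hf : IsPuiseuxWith M f) (hg : IsPuiseuxWith M g) :
    IsPuiseuxWith M fun z => f z * g z := by
  obtain ⟨F, hF, hfF⟩ := hf
  obtain ⟨G, hG, hgG⟩ := hg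
  exact ⟨F * G, hF.mul hG, by filter_upwards [hfF, hgG] with z h1 h2; simp [h1, h2]⟩

theorem neg (hf : IsPuiseuxWith M f) : IsPuiseuxWith M fun z => - f z := by
  obtain ⟨F, hF, hfF⟩ := hf
  exact ⟨-F, hF.neg, by filter_upwards [hfF] with z h1; simp [h1]⟩

theorem inv (hf : IsPuiseuxWith M f) : IsPuiseuxWith M fun z => (f z)⁻¹ := by
  obtain ⟨F, hF, hfF⟩ := hf
  exact ⟨F⁻¹, hF.inv, by filter_upwards [hfF] with z h1; simp [h1]⟩

theorem const (c : ℂ) : IsPuiseuxWith M fun _ => c :=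
  ⟨fun _ => c, MeromorphicAt.const c 0, by simp⟩

theorem qParam : IsPuiseuxWith M (Function.Periodic.qParam M) :=
  ⟨id, MeromorphicAt.id 0, by simp⟩

theorem eventually_eq_zero_or_eventually_ne_zero (hM : 0 < M) (hf : IsPuiseuxWith M f) :
    (∀ᶠ z in imInfty, f z = 0) ∨ ∀ᶠ z in imInfty, f z ≠ 0 := by
  obtain ⟨F, hF, hfF⟩ := hf
  refine hF.eventually_eq_zero_or_eventually_ne_zero.imp (fun h => ?_) fun h => ?_
  all_goals
    filter_upwards [hfF, (eventually_qParam_iff hM).mpr h] with z h1 h2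
    rwa [h1]

theorem eventually_differentiableAt (hM : 0 < M) (hf : IsPuiseuxWith M f) :
    ∀ᶠ z in imInfty, DifferentiableAt ℂ f z := by
  obtain ⟨F, hF, hfF⟩ := hf
  obtain ⟨R, hR⟩ := eventually_imInfty.mp
    (hfF.and ((eventually_qParam_iff hM).mpr hF.eventually_analyticAt))
  refine eventually_imInfty.mpr ⟨R, fun z hz => ?_⟩
  have h1 : DifferentiableAt ℂ (fun z => F (Function.Periodic.qParam M z)) z :=
    (hR z hz).2.differentiableAt.comp z Function.Periodic.differentiable_qParam.differentiableAt
  refine h1.congr_of_eventuallyEq ?_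
  filter_upwards [(isOpen_lt continuous_const Complex.continuous_im).mem_nhds hz] with w hw
  exact (hR w hw).1

theorem eventually_add_nat (hM : 0 < M) (hf : IsPuiseuxWith M f) :
    ∀ᶠ z in imInfty, ∀ k : ℕ, f (z + (k * M : ℕ)) = f z := by
  obtain ⟨F, hF, hfF⟩ := hf
  filter_upwards [hfF, eventually_imInfty_add_nat hfF] with z hz hz' k
  rw [hz' (k * M), hz, qParam_add_nat hM]

theorem exists_isBigO (hM : 0 < M) (hf : IsPuiseuxWith M f) : ∃ n₀ : ℕ, ∀ n, n₀ ≤ n →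
    (fun z => Function.Periodic.qParam M z ^ n * f z) =O[imInfty] fun _ => (1 : ℝ) := by
  obtain ⟨F, ⟨n₀, hF⟩, hfF⟩ := hf
  have hM' : (0 : ℝ) < M := by exact_mod_cast hM
  refine ⟨n₀, fun n hn => ?_⟩
  have h1 : (fun s : ℂ => s ^ n * F s) =O[nhds 0] fun _ => (1 : ℝ) := by
    have h2 : ContinuousAt (fun s : ℂ => s ^ (n - n₀) * ((s - 0) ^ n₀ • F s)) 0 :=
      (continuousAt_id.pow _).mul hF.continuousAt
    refine (h2.tendsto.isBigO_one ℝ).congr_left fun s => ?_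
    rw [sub_zero, smul_eq_mul, ← mul_assoc, ← pow_add, Nat.sub_add_cancel hn]
  refine (h1.comp_tendsto ((Function.Periodic.qParam_tendsto hM').mono_right
    nhdsWithin_le_nhds)).congr' ?_ (by rfl)
  filter_upwards [hfF] with z hz
  simp [hz]

/-- A Puiseux function with a finite limit at `i∞` is an analytic function of the parameter. -/
theorem exists_analyticAt_of_tendsto (hM : 0 < M) (hf : IsPuiseuxWith M f) {c : ℂ}
    (hc : Filter.Tendsto f imInfty (nhds c)) :
    ∃ G : ℂ → ℂ, AnalyticAt ℂ G 0 ∧ G 0 = c ∧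
      ∀ᶠ z in imInfty, f z = G (Function.Periodic.qParam M z) := by
  classical
  obtain ⟨F, hF, hfF⟩ := hf
  have hM' : (0 : ℝ) < M := by exact_mod_cast hM
  have hlim : Filter.Tendsto F (nhdsWithin 0 {0}ᶜ) (nhds c) := by
    refine (hc.comp (Function.Periodic.invQParam_tendsto hM')).congr' ?_
    filter_upwards [(Function.Periodic.invQParam_tendsto hM').eventually hfF,
      self_mem_nhdsWithin] with s hs hs0
    rw [Function.comp_apply, hs, Function.Periodic.qParam_right_inv hM'.ne' hs0]
  refine ⟨Function.update F 0 c, (hF.update 0 c).analyticAt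
    (continuousAt_update_same.mpr hlim), by simp, ?_⟩
  filter_upwards [hfF] with z hz
  rw [hz, Function.update_of_ne (Function.Periodic.qParam_ne_zero z)]

theorem exists_tendsto_or_inv (hM : 0 < M) (hf : IsPuiseuxWith M f) :
    (∃ c, Filter.Tendsto f imInfty (nhds c)) ∨
      Filter.Tendsto (fun z => (f z)⁻¹) imInfty (nhds 0) := by
  obtain ⟨F, hF, hfF⟩ := hf
  have hM' : (0 : ℝ) < M := by exact_mod_cast hM
  have hq := Function.Periodic.qParam_tendsto hM'
  rcases le_or_gt 0 (meromorphicOrderAt F 0) with h | h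
  · obtain ⟨c, hc⟩ := tendsto_nhds_of_meromorphicOrderAt_nonneg hF h
    exact .inl ⟨c, (hc.comp hq).congr' (hfF.mono fun z hz => hz.symm)⟩
  · have := Filter.tendsto_inv₀_cobounded.comp
      (tendsto_cobounded_of_meromorphicOrderAt_neg h)
    exact .inr ((this.comp hq).congr' (hfF.mono fun z hz => by simp [hz]))

end IsPuiseuxWith

theorem Polynomial.IsRoot.norm_le_sum_norm_coeff {P : Polynomial ℂ} (hP : P.Monic) {x : ℂ}
    (hx : P.IsRoot x) : ‖x‖ ≤ ∑ i ∈ Finset.range P.natDegree, ‖P.coeff i‖ + 1 := by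
  have h := (hx.norm_lt_cauchyBound hP.ne_zero).le
  rw [Polynomial.cauchyBound, hP.leadingCoeff, nnnorm_one, div_one] at h
  have h2 : (Finset.range P.natDegree).sup (fun i => ‖P.coeff i‖₊) ≤
      ∑ i ∈ Finset.range P.natDegree, ‖P.coeff i‖₊ :=
    Finset.sup_le fun i hi => Finset.single_le_sum (f := fun i => ‖P.coeff i‖₊)
      (fun _ _ => zero_le) hi
  have h3 : ‖x‖₊ ≤ ∑ i ∈ Finset.range P.natDegree, ‖P.coeff i‖₊ + 1 := h.trans (by gcongr)
  have h4 : (‖x‖₊ : ℝ) ≤ (∑ i ∈ Finset.range P.natDegree, ‖P.coeff i‖₊ + 1 : NNReal) := h3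
  simpa using h4

section HolomorphicFamily

variable {Ω : Set ℂ} {N : ℕ} {P : ℂ → Polynomial ℂ}

/-- The evaluation map of a family of polynomials with holomorphic coefficients is `C¹`. -/
theorem contDiffAt_eval_family (ho : IsOpen Ω) (hdeg : ∀ z ∈ Ω, (P z).natDegree = N)
    (hdiff : ∀ i, DifferentiableOn ℂ (fun z => (P z).coeff i) Ω) {z₀ : ℂ} (hz₀ : z₀ ∈ Ω) (x₀ : ℂ) :
    ContDiffAt ℂ 1 (fun v : ℂ × ℂ => (P v.1).eval v.2) (z₀, x₀) := by
  have h1 : ContDiffAt ℂ 1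
      (fun v : ℂ × ℂ => ∑ i ∈ Finset.range (N + 1), (P v.1).coeff i * v.2 ^ i) (z₀, x₀) := by
    refine ContDiffAt.sum fun i _ => ContDiffAt.mul ?_ (contDiffAt_snd.pow i)
    exact (((hdiff i).contDiffOn ho).contDiffAt (ho.mem_nhds hz₀)).comp (z₀, x₀) contDiffAt_fst
  refine h1.congr_of_eventuallyEq ?_
  have h2 : ∀ᶠ v : ℂ × ℂ in nhds (z₀, x₀), v.1 ∈ Ω :=
    continuousAt_fst.eventually (ho.mem_nhds hz₀)
  filter_upwards [h2] with v hv
  rw [Polynomial.eval_eq_sum_range, hdeg _ hv]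

/-- A simple root of a polynomial with holomorphic coefficients is locally a holomorphic
function of the parameter. -/
theorem exists_differentiableAt_local_root (ho : IsOpen Ω)
    (hdeg : ∀ z ∈ Ω, (P z).natDegree = N)
    (hdiff : ∀ i, DifferentiableOn ℂ (fun z => (P z).coeff i) Ω) {z₀ x₀ : ℂ} (hz₀ : z₀ ∈ Ω)
    (h0 : (P z₀).eval x₀ = 0) (h1 : (P z₀).derivative.eval x₀ ≠ 0) :
    ∃ ψ : ℂ → ℂ, DifferentiableAt ℂ ψ z₀ ∧ ψ z₀ = x₀ ∧
      ∀ᶠ v : ℂ × ℂ in nhds (z₀, x₀), (P v.1).eval v.2 = 0 ↔ ψ v.1 = v.2 := by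
  have hs := (contDiffAt_eval_family ho hdeg hdiff hz₀ x₀).hasStrictFDerivAt one_ne_zero
  set F' := fderiv ℂ (fun v : ℂ × ℂ => (P v.1).eval v.2) (z₀, x₀)
  have hinr : F' ∘L .inr ℂ ℂ ℂ =
      (ContinuousLinearEquiv.unitsEquivAut ℂ (Units.mk0 _ h1) : ℂ →L[ℂ] ℂ) := by
    have h2 := hs.hasFDerivAt.comp x₀ (hasFDerivAt_prodMk_right z₀ x₀)
    have h3 := (P z₀).hasDerivAt x₀
    ext
    have := (h2.hasDerivAt.unique h3)
    simpa using this
  have hinv : (F' ∘L .inr ℂ ℂ ℂ).IsInvertible := ⟨_, hinr.symm⟩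
  refine ⟨hs.implicitFunctionOfProdDomain hinv,
    (hs.hasStrictFDerivAt_implicitFunctionOfProdDomain hinv).hasFDerivAt.differentiableAt, ?_, ?_⟩
  · exact (hs.eventually_apply_eq_iff_implicitFunctionOfProdDomain hinv).self_of_nhds.mp rfl
  · have := hs.eventually_apply_eq_iff_implicitFunctionOfProdDomain hinv
    simpa only [h0] using this

/-- A family of monic separable polynomials with holomorphic coefficients on a convex domain
has a holomorphic root. -/
theorem exists_differentiableOn_root (ho : IsOpen Ω) (hc : Convex ℝ Ω) (hne : Ω.Nonempty)
    (hN : N ≠ 0) (hmonic : ∀ z ∈ Ω, (P z).Monic) (hdeg : ∀ z ∈ Ω, (P z).natDegree = N)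
    (hdiff : ∀ i, DifferentiableOn ℂ (fun z => (P z).coeff i) Ω)
    (hsimple : ∀ z ∈ Ω, ∀ x, (P z).eval x = 0 → (P z).derivative.eval x ≠ 0) :
    ∃ f : ℂ → ℂ, DifferentiableOn ℂ f Ω ∧ ∀ z ∈ Ω, (P z).eval (f z) = 0 := by
  let E := {v : Ω × ℂ // (P v.1).eval v.2 = 0}
  let p : E → Ω := fun e => e.1.1
  have hpc : Continuous p := continuous_fst.comp continuous_subtype_val
  have hevc : Continuous fun v : Ω × ℂ => (P v.1).eval v.2 := by
    rw [continuous_iff_continuousAt]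
    rintro ⟨z, x⟩
    have h1 := (contDiffAt_eval_family ho hdeg hdiff z.2 x).continuousAt
    have h2 : Continuous fun v : Ω × ℂ => ((v.1 : ℂ), v.2) :=
      (continuous_subtype_val.comp continuous_fst).prodMk continuous_snd
    exact ContinuousAt.comp_of_eq h1 h2.continuousAt rfl
  have hlocal : ∀ e : E, ∃ ψ : ℂ → ℂ, DifferentiableAt ℂ ψ e.1.1 ∧ ψ e.1.1 = e.1.2 ∧
      ∀ᶠ v : ℂ × ℂ in nhds ((e.1.1 : ℂ), e.1.2), (P v.1).eval v.2 = 0 ↔ ψ v.1 = v.2 := fun e =>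
    exists_differentiableAt_local_root ho hdeg hdiff e.1.1.2 e.2 (hsimple _ e.1.1.2 _ e.2)
  have hclosed : IsClosedMap p := by
    apply IsProperMap.isClosedMap
    rw [isProperMap_iff_ultrafilter]
    refine ⟨hpc, fun 𝒰 z hz => ?_⟩
    have hbd : ContinuousAt
        (fun w : Ω => ∑ i ∈ Finset.range N, ‖(P w).coeff i‖ + 1) z := by
      refine ContinuousAt.add (tendsto_finsetSum _ fun i _ => ?_) continuousAt_const
      have := ((hdiff i).continuousOn.continuousAt (ho.mem_nhds z.2)).norm
      exact this.comp (f := fun w : Ω => (w : ℂ)) continuousAt_subtype_val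
    have hball : ∀ᶠ e in (𝒰 : Filter E), e.1.2 ∈ Metric.closedBall (0 : ℂ)
        (∑ i ∈ Finset.range N, ‖(P z).coeff i‖ + 1 + 1) := by
      filter_upwards [hz.eventually (hbd.eventually_lt_const (lt_add_one _))] with e he
      rw [mem_closedBall_zero_iff]
      have h1 := Polynomial.IsRoot.norm_le_sum_norm_coeff (hmonic _ e.1.1.2) e.2
      rw [hdeg _ e.1.1.2] at h1
      exact h1.trans he.le
    obtain ⟨x, -, hx⟩ := (isCompact_closedBall _ _).ultrafilter_le_nhds
      (𝒰.map fun e : E => e.1.2) (Filter.le_principal_iff.mpr hball)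
    have hzx : Filter.Tendsto (fun e : E => e.1) 𝒰 (nhds (z, x)) := by
      rw [nhds_prod_eq]
      exact Filter.Tendsto.prodMk hz hx
    have hroot : (P z).eval x = 0 := by
      refine tendsto_nhds_unique ((hevc.tendsto (z, x)).comp hzx) ?_
      exact tendsto_const_nhds.congr fun e => e.2.symm
    refine ⟨⟨(z, x), hroot⟩, rfl, ?_⟩
    rw [nhds_subtype_eq_comap]
    exact Filter.map_le_iff_le_comap.mp hzx
  have hfin : ∀ z ∈ Set.univ, (p ⁻¹' {z}).Finite := by
    intro z _
    refine Set.Finite.of_finite_image (f := fun e : E => e.1.2) ?_ ?_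
    · refine (P z).roots.toFinset.finite_toSet.subset ?_
      rintro _ ⟨e, rfl, rfl⟩
      rw [Finset.mem_coe, Multiset.mem_toFinset, Polynomial.mem_roots (hmonic _ e.1.1.2).ne_zero]
      exact e.2
    · rintro e he e' he' h
      exact Subtype.ext (Prod.ext (he.trans he'.symm) h)
  have hval : ∀ e : E, Filter.Tendsto (fun e' : E => ((e'.1.1 : ℂ), e'.1.2)) (nhds e)
      (nhds ((e.1.1 : ℂ), e.1.2)) := fun e =>
    Continuous.tendsto ((continuous_subtype_val.comp hpc).prodMk
      (continuous_snd.comp continuous_subtype_val)) e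
  have hopen : IsOpenMap p := by
    refine IsOpenMap.of_nhds_le fun e => ?_
    obtain ⟨ψ, hψd, hψe, hψ⟩ := hlocal e
    have hψt : Filter.Tendsto (fun w : Ω => ((w : ℂ), ψ w)) (nhds e.1.1)
        (nhds ((e.1.1 : ℂ), e.1.2)) := by
      rw [nhds_prod_eq]
      refine Filter.Tendsto.prodMk (continuous_subtype_val.tendsto _) ?_
      rw [← hψe]
      exact hψd.continuousAt.tendsto.comp (continuous_subtype_val.tendsto _)
    have hroot : ∀ᶠ w : Ω in nhds e.1.1, (P w).eval (ψ w) = 0 := by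
      filter_upwards [hψt.eventually hψ] with w hw
      exact hw.mpr rfl
    intro s hs
    rw [Filter.mem_map, nhds_subtype_eq_comap, Filter.mem_comap] at hs
    obtain ⟨u, hu, hus⟩ := hs
    have hψt' : Filter.Tendsto (fun w : Ω => (w, ψ w)) (nhds e.1.1) (nhds (e.1.1, e.1.2)) :=
      Filter.Tendsto.prodMk_nhds Filter.tendsto_id ((continuous_snd.tendsto _).comp hψt)
    filter_upwards [hroot, hψt' hu] with w hw hwu
    exact hus (a := ⟨(w, ψ w), hw⟩) hwu
  have hinj : IsLocallyInjective p := by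
    rw [isLocallyInjective_iff_nhds]
    intro e
    obtain ⟨ψ, -, -, hψ⟩ := hlocal e
    refine ⟨_, (hval e).eventually hψ, ?_⟩
    rintro e₁ he₁ e₂ he₂ h
    refine Subtype.ext (Prod.ext h ?_)
    rw [← he₁.mp e₁.2, ← he₂.mp e₂.2, show e₁.1.1 = e₂.1.1 from h]
  have hlh : IsLocalHomeomorph p := by
    rw [isLocalHomeomorph_iff_isOpenEmbedding_restrict]
    intro e
    obtain ⟨U, hU, heU, hUi⟩ := hinj e
    exact ⟨U, hU.mem_nhds heU, .of_continuous_injective_isOpenMap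
      (hpc.comp continuous_subtype_val) hUi.injective (hopen.comp hU.isOpenMap_subtype_val)⟩
  have hcov : IsCoveringMap p := isCoveringMap_iff_isCoveringMapOn_univ.mpr <|
    hclosed.isCoveringMapOn_of_isLocalHomeomorphOn hfin hlh.isLocalHomeomorphOn
  have := ho.locallyPathConnectedSpace
  have := hc.contractibleSpace hne
  obtain ⟨z₀, hz₀⟩ := hne
  obtain ⟨x₀, hx₀⟩ := IsAlgClosed.exists_root (P z₀) (by
    rw [Polynomial.degree_eq_natDegree (hmonic z₀ hz₀).ne_zero, hdeg z₀ hz₀]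
    exact_mod_cast hN)
  obtain ⟨G, ⟨-, hG⟩, -⟩ := hcov.existsUnique_continuousMap_lifts (ContinuousMap.id Ω)
    ⟨z₀, hz₀⟩ ⟨(⟨z₀, hz₀⟩, x₀), hx₀⟩ rfl
  have hG1 : ∀ w : Ω, (G w).1.1 = w := fun w => congrFun hG w
  classical
  let f : ℂ → ℂ := fun z => if hz : z ∈ Ω then (G ⟨z, hz⟩).1.2 else 0
  have hf : ∀ w : Ω, f w = (G w).1.2 := fun w => by simp [f]
  have hroot : ∀ z ∈ Ω, (P z).eval (f z) = 0 := by
    intro z hz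
    have h1 := (G ⟨z, hz⟩).2
    rw [hG1] at h1
    rwa [hf ⟨z, hz⟩]
  refine ⟨f, fun z hz => DifferentiableAt.differentiableWithinAt ?_, hroot⟩
  have hfc : ContinuousAt f z := by
    have h1 : Continuous fun w : Ω => f w := by
      simp only [hf]
      exact continuous_snd.comp (continuous_subtype_val.comp G.continuous)
    exact (continuousOn_iff_continuous_domRestrict.mpr h1).continuousAt (ho.mem_nhds hz)
  obtain ⟨ψ, hψd, -, hψ⟩ := exists_differentiableAt_local_root ho hdeg hdiff hz (hroot z hz)
    (hsimple z hz _ (hroot z hz))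
  refine hψd.congr_of_eventuallyEq ?_
  have h2 : Filter.Tendsto (fun w => (w, f w)) (nhds z) (nhds (z, f z)) :=
    continuousAt_id.prodMk hfc
  filter_upwards [h2.eventually hψ, ho.mem_nhds hz] with w hw hwΩ
  exact (hw.mp (hroot w hwΩ)).symm

end HolomorphicFamily

theorem exists_common_isPuiseuxWith {ι : Type} [Fintype ι] {f : ι → ℂ → ℂ}
    (hf : ∀ i, ∃ M, 0 < M ∧ IsPuiseuxWith M (f i)) :
    ∃ M, 0 < M ∧ ∀ i, IsPuiseuxWith M (f i) := by
  choose M hM hfM using hf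
  have h : 0 < ∏ i, M i := Finset.prod_pos fun i _ => hM i
  exact ⟨∏ i, M i, h, fun i => (hfM i).of_dvd h (Finset.dvd_prod_of_mem _ (Finset.mem_univ i))⟩

/-- If a finite product of analytic functions vanishes on a preconnected set, so does a factor. -/
theorem AnalyticOnNhd.exists_eq_zero_of_prod_eq_zero {ι : Type} {U : Set ℂ}
    (hU : IsPreconnected U) (s : Finset ι) {f : ι → ℂ → ℂ}
    (hf : ∀ i ∈ s, AnalyticOnNhd ℂ (f i) U) (hne : U.Nonempty)
    (h : ∀ z ∈ U, ∏ i ∈ s, f i z = 0) : ∃ i ∈ s, ∀ z ∈ U, f i z = 0 := by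
  classical
  induction s using Finset.induction_on with
  | empty =>
    obtain ⟨z, hz⟩ := hne
    simpa using h z hz
  | insert a s ha ih =>
    have h1 : AnalyticOnNhd ℂ (fun z => ∏ i ∈ s, f i z) U :=
      Finset.analyticOnNhd_fun_prod s fun i hi => hf i (Finset.mem_insert_of_mem hi)
    rcases (hf a (Finset.mem_insert_self a s)).eq_zero_or_eq_zero_of_mul_eq_zero h1
      (fun z hz => by
        have h2 := h z hz
        rwa [Finset.prod_insert ha] at h2) hU with h2 | h2
    · exact ⟨a, Finset.mem_insert_self a s, h2⟩
    · obtain ⟨i, hi, h3⟩ := ih (fun i hi => hf i (Finset.mem_insert_of_mem hi)) h2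
      exact ⟨i, Finset.mem_insert_of_mem hi, h3⟩

/-- A holomorphic root of a family of polynomials that is invariant under translation by `M`
is invariant under translation by some multiple of `M`. -/
theorem exists_period_of_root {M N : ℕ} {R : ℝ} {P : ℂ → Polynomial ℂ} {f : ℂ → ℂ}
    (hmonic : ∀ z, (P z).Monic) (hdeg : ∀ z, (P z).natDegree = N)
    (hper : ∀ z : ℂ, R < z.im → ∀ k : ℕ, P (z + (k * M : ℕ)) = P z)
    (hf : DifferentiableOn ℂ f {z | R < z.im}) (hroot : ∀ z : ℂ, R < z.im → (P z).eval (f z) = 0) :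
    ∃ k : ℕ, 0 < k ∧ ∀ z : ℂ, R < z.im → f (z + (k * M : ℕ)) = f z := by
  classical
  let Ω : Set ℂ := {z | R < z.im}
  have hΩo : IsOpen Ω := isOpen_lt continuous_const Complex.continuous_im
  have hΩc : IsPreconnected Ω := (convex_halfSpace_im_gt R).isPreconnected
  have hΩne : Ω.Nonempty := ⟨⟨0, R + 1⟩, by simp [Ω]⟩
  have hshift : ∀ k : ℕ, ∀ z ∈ Ω, z + (k * M : ℕ) ∈ Ω := fun k z hz => by
    simpa [Ω] using hz
  have hfk : ∀ k : ℕ, AnalyticOnNhd ℂ (fun z => f (z + (k * M : ℕ))) Ω := fun k =>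
    DifferentiableOn.analyticOnNhd
      (hf.comp (g := f) (f := fun z : ℂ => z + (k * M : ℕ)) (by fun_prop) (hshift k)) hΩo
  let s : Finset (ℕ × ℕ) :=
    (Finset.range (N + 1) ×ˢ Finset.range (N + 1)).filter fun p => p.1 < p.2
  obtain ⟨p, hp, hpz⟩ := AnalyticOnNhd.exists_eq_zero_of_prod_eq_zero hΩc s
    (f := fun p z => f (z + (p.2 * M : ℕ)) - f (z + (p.1 * M : ℕ)))
    (fun p _ => (hfk p.2).sub (hfk p.1)) hΩne (by
      intro z hz
      obtain ⟨i, hi, j, hj, hij, hfij⟩ := Finset.exists_ne_map_eq_of_card_lt_of_maps_to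
        (s := Finset.range (N + 1)) (t := (P z).roots.toFinset)
        (f := fun k : ℕ => f (z + (k * M : ℕ))) (by
          rw [Finset.card_range, Nat.lt_succ_iff]
          exact (Multiset.toFinset_card_le _).trans ((Polynomial.card_roots' _).trans (hdeg z).le))
        (by
          intro k _
          rw [Finset.mem_coe, Multiset.mem_toFinset, Polynomial.mem_roots (hmonic z).ne_zero,
            Polynomial.IsRoot, ← hper z hz k]
          exact hroot _ (hshift k z hz))
      rcases hij.lt_or_gt with h | h
      · exact Finset.prod_eq_zero (i := (i, j))
          (Finset.mem_filter.mpr ⟨Finset.mk_mem_product hi hj, h⟩) (sub_eq_zero.mpr hfij.symm)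
      · exact Finset.prod_eq_zero (i := (j, i))
          (Finset.mem_filter.mpr ⟨Finset.mk_mem_product hj hi, h⟩) (sub_eq_zero.mpr hfij))
  have hlt : p.1 < p.2 := (Finset.mem_filter.mp hp).2
  refine ⟨p.2 - p.1, Nat.sub_pos_of_lt hlt, fun z hz => ?_⟩
  have h0 : f ((z - (p.1 * M : ℕ)) + (p.2 * M : ℕ)) - f ((z - (p.1 * M : ℕ)) + (p.1 * M : ℕ)) = 0 :=
    hpz _ (by simpa [Ω] using hz)
  rw [sub_add_cancel, sub_eq_zero] at h0
  rw [← h0]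
  congr 1
  rw [Nat.sub_mul, Nat.cast_sub (Nat.mul_le_mul_right M hlt.le)]
  ring

/-- A periodic holomorphic function of moderate growth at `i∞` is a Puiseux function. -/
theorem isPuiseuxWith_of_isBigO {M : ℕ} (hM : 0 < M) {R : ℝ} {f : ℂ → ℂ}
    (hf : DifferentiableOn ℂ f {z | R < z.im})
    (hper : ∀ z : ℂ, R < z.im → f (z + (M : ℕ)) = f z) {n : ℕ}
    (hbd : (fun z => Function.Periodic.qParam M z ^ n * f z) =O[imInfty] fun _ => (1 : ℝ)) :
    IsPuiseuxWith M f := by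
  classical
  have hM' : (0 : ℝ) < M := by exact_mod_cast hM
  let F : ℂ → ℂ := fun z => if R < z.im then Function.Periodic.qParam M z ^ n * f z else 0
  have hFf : ∀ z : ℂ, R < z.im → F z = Function.Periodic.qParam M z ^ n * f z := fun z hz => by
    simp [F, hz]
  have hFev : ∀ᶠ z in imInfty, F z = Function.Periodic.qParam M z ^ n * f z :=
    eventually_imInfty.mpr ⟨R, hFf⟩
  have hFper : Function.Periodic F (M : ℝ) := by
    intro z
    have h1 := qParam_add_nat hM 1 z
    rw [one_mul] at h1
    by_cases hz : R < z.im
    · rw [Complex.ofReal_natCast, hFf z hz, hFf _ (by simpa using hz), hper z hz, h1]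
    · simp [F, hz]
  have hFd : ∀ᶠ z in imInfty, DifferentiableAt ℂ F z := by
    refine eventually_imInfty.mpr ⟨R, fun z hz => ?_⟩
    have ho : {z : ℂ | R < z.im} ∈ nhds z :=
      (isOpen_lt continuous_const Complex.continuous_im).mem_nhds hz
    have h1 : DifferentiableAt ℂ (fun z => Function.Periodic.qParam M z ^ n * f z) z :=
      (Function.Periodic.differentiable_qParam.differentiableAt.pow n).mul
        ((hf z hz).differentiableAt ho)
    exact h1.congr_of_eventuallyEq (Filter.mem_of_superset ho hFf)
  have hFb : Filter.BoundedAtFilter imInfty F :=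
    (hbd.congr' (hFev.mono fun z hz => hz.symm) (by rfl)).trans (Asymptotics.isBigO_refl _ _)
  have han : AnalyticAt ℂ (Function.Periodic.cuspFunction M F) 0 := by
    rw [Complex.analyticAt_iff_eventually_differentiableAt]
    have h1 := Function.Periodic.eventually_differentiableAt_cuspFunction_nhds_ne_zero hM' hFper hFd
    have h2 := Function.Periodic.differentiableAt_cuspFunction_zero hM' hFper hFd hFb
    rw [eventually_nhdsWithin_iff] at h1
    filter_upwards [h1] with s hs
    by_cases hs0 : s = 0
    · rwa [hs0]
    · exact hs hs0
  refine ⟨fun s => (s ^ n)⁻¹ * Function.Periodic.cuspFunction M F s, ?_, ?_⟩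
  · exact ((MeromorphicAt.id 0).pow n).inv.mul han.meromorphicAt
  · filter_upwards [hFev] with z hz
    rw [Function.Periodic.eq_cuspFunction hM'.ne' hFper, hz, inv_mul_cancel_left₀]
    exact pow_ne_zero _ (Function.Periodic.qParam_ne_zero z)

/-- The Newton–Puiseux theorem: a family of monic separable polynomials whose coefficients are
Puiseux functions has a root that is a Puiseux function. -/
theorem exists_isPuiseuxWith_root {N : ℕ} (hN : N ≠ 0) {P : ℂ → Polynomial ℂ}
    (hmonic : ∀ z, (P z).Monic) (hdeg : ∀ z, (P z).natDegree = N)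
    (hcoeff : ∀ i, ∃ M, 0 < M ∧ IsPuiseuxWith M fun z => (P z).coeff i)
    (hsimple : ∀ᶠ z in imInfty, ∀ x, (P z).eval x = 0 → (P z).derivative.eval x ≠ 0) :
    ∃ f : ℂ → ℂ, (∃ M, 0 < M ∧ IsPuiseuxWith M f) ∧ ∀ᶠ z in imInfty, (P z).eval (f z) = 0 := by
  obtain ⟨M, hM, hPM⟩ := exists_common_isPuiseuxWith (ι := Fin N)
    (f := fun i z => (P z).coeff i) fun i => hcoeff i
  have hcoeff' : ∀ i, IsPuiseuxWith M fun z => (P z).coeff i := by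
    intro i
    rcases lt_trichotomy i N with h | rfl | h
    · exact hPM ⟨i, h⟩
    · refine (IsPuiseuxWith.const 1).congr (.of_forall fun z => ?_)
      rw [← hdeg z]; exact hmonic z
    · refine (IsPuiseuxWith.const 0).congr (.of_forall fun z => ?_)
      exact Polynomial.coeff_eq_zero_of_natDegree_lt (by rwa [hdeg z])
  have hdiff : ∀ᶠ z in imInfty, ∀ i : Fin N, DifferentiableAt ℂ (fun z => (P z).coeff i) z :=
    Filter.eventually_all.mpr fun i => (hPM i).eventually_differentiableAt hM
  have hper : ∀ᶠ z in imInfty, ∀ i : Fin N, ∀ k : ℕ,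
      (P (z + (k * M : ℕ))).coeff i = (P z).coeff i :=
    Filter.eventually_all.mpr fun i => (hPM i).eventually_add_nat hM
  obtain ⟨R, hR⟩ := eventually_imInfty.mp (hdiff.and (hper.and hsimple))
  have hext : ∀ z w, (∀ i : Fin N, (P z).coeff i = (P w).coeff i) → P z = P w := by
    intro z w h
    ext i
    rcases lt_trichotomy i N with hi | rfl | hi
    · exact h ⟨i, hi⟩
    · have h1 : ∀ z, (P z).coeff i = 1 := fun z => by
        have h2 := hmonic z
        rwa [Polynomial.Monic, Polynomial.leadingCoeff, hdeg z] at h2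
      rw [h1, h1]
    · rw [Polynomial.coeff_eq_zero_of_natDegree_lt (by rwa [hdeg z]),
        Polynomial.coeff_eq_zero_of_natDegree_lt (by rwa [hdeg w])]
  have hΩo : IsOpen {z : ℂ | R < z.im} := isOpen_lt continuous_const Complex.continuous_im
  have hdiffOn : ∀ i, DifferentiableOn ℂ (fun z => (P z).coeff i) {z : ℂ | R < z.im} := by
    intro i
    rcases lt_trichotomy i N with hi | rfl | hi
    · exact fun z hz => ((hR z hz).1 ⟨i, hi⟩).differentiableWithinAt
    · refine (differentiableOn_const 1).congr fun z _ => ?_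
      have h2 := hmonic z
      rwa [Polynomial.Monic, Polynomial.leadingCoeff, hdeg z] at h2
    · exact (differentiableOn_const 0).congr fun z _ =>
        Polynomial.coeff_eq_zero_of_natDegree_lt (by rwa [hdeg z])
  obtain ⟨f, hf, hroot⟩ := exists_differentiableOn_root hΩo (convex_halfSpace_im_gt R)
    ⟨⟨0, R + 1⟩, by simp⟩ hN (fun z _ => hmonic z) (fun z _ => hdeg z) hdiffOn
    fun z hz => (hR z hz).2.2
  obtain ⟨k, hk, hkf⟩ := exists_period_of_root hmonic hdeg
    (fun z hz k => hext _ _ fun i => (hR z hz).2.1 i k) hf hroot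
  choose n hn using fun i : Fin N => (hPM i).exists_isBigO hM
  have hbdf : ∀ z : ℂ, R < z.im → ‖f z‖ ≤ ∑ i : Fin N, ‖(P z).coeff i‖ + 1 := by
    intro z hz
    have h1 := Polynomial.IsRoot.norm_le_sum_norm_coeff (hmonic z) (hroot z hz)
    rwa [hdeg z, Finset.sum_range] at h1
  have hsum : (fun z => ∑ i : Fin N, ‖Function.Periodic.qParam M z ^ (∑ i, n i) * (P z).coeff i‖ +
      ‖Function.Periodic.qParam M z ^ (∑ i, n i)‖) =O[imInfty] fun _ => (1 : ℝ) := by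
    refine (Asymptotics.IsBigO.fun_sum fun i _ => ?_).add ?_
    · exact (hn i _ (Finset.single_le_sum (fun _ _ => Nat.zero_le _)
        (Finset.mem_univ i))).norm_left
    · have h1 : Filter.Tendsto (Function.Periodic.qParam M) imInfty (nhds 0) :=
        (Function.Periodic.qParam_tendsto (by exact_mod_cast hM)).mono_right nhdsWithin_le_nhds
      exact ((h1.pow _).isBigO_one ℝ).norm_left
  have hbig : (fun z => Function.Periodic.qParam M z ^ (∑ i, n i) * f z) =O[imInfty]
      fun _ => (1 : ℝ) := by
    refine Asymptotics.IsBigO.trans (Asymptotics.IsBigO.of_bound' ?_) hsum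
    refine eventually_imInfty.mpr ⟨R, fun z hz => ?_⟩
    rw [norm_mul]
    refine (mul_le_mul_of_nonneg_left (hbdf z hz) (norm_nonneg _)).trans ?_
    refine le_trans (le_of_eq ?_) (le_abs_self _)
    simp only [norm_mul]
    rw [mul_add, Finset.mul_sum, mul_one]
  refine ⟨f, ⟨k * M, Nat.mul_pos hk hM, ?_⟩, eventually_imInfty.mpr ⟨R, hroot⟩⟩
  refine isPuiseuxWith_of_isBigO (n := k * ∑ i, n i) (Nat.mul_pos hk hM) hf hkf ?_
  simpa only [pow_mul, qParam_mul_pow hk] using hbig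

/-- The ring of germs at `i∞` of Puiseux functions. -/
def puiseuxSubring : Subring (Filter.Germ imInfty ℂ) where
  carrier := {g | ∃ f : ℂ → ℂ, (∃ M, 0 < M ∧ IsPuiseuxWith M f) ∧ (f : Filter.Germ imInfty ℂ) = g}
  mul_mem' := by
    rintro _ _ ⟨f, ⟨M, hM, hf⟩, rfl⟩ ⟨g, ⟨M', hM', hg⟩, rfl⟩
    exact ⟨f * g, ⟨M * M', Nat.mul_pos hM hM', (hf.of_dvd (Nat.mul_pos hM hM') ⟨_, rfl⟩).mul
      (hg.mul_left hM)⟩, rfl⟩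
  add_mem' := by
    rintro _ _ ⟨f, ⟨M, hM, hf⟩, rfl⟩ ⟨g, ⟨M', hM', hg⟩, rfl⟩
    exact ⟨f + g, ⟨M * M', Nat.mul_pos hM hM', (hf.of_dvd (Nat.mul_pos hM hM') ⟨_, rfl⟩).add
      (hg.mul_left hM)⟩, rfl⟩
  one_mem' := ⟨1, ⟨1, one_pos, .const 1⟩, rfl⟩
  zero_mem' := ⟨0, ⟨1, one_pos, .const 0⟩, rfl⟩
  neg_mem' := by
    rintro _ ⟨f, ⟨M, hM, hf⟩, rfl⟩
    exact ⟨-f, ⟨M, hM, hf.neg⟩, rfl⟩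

theorem isField_puiseuxSubring : IsField puiseuxSubring where
  exists_pair_ne := ⟨0, 1, zero_ne_one⟩
  mul_comm := mul_comm
  mul_inv_cancel := by
    rintro ⟨_, f, ⟨M, hM, hf⟩, rfl⟩ h
    refine ⟨⟨_, fun z => (f z)⁻¹, ⟨M, hM, hf.inv⟩, rfl⟩, Subtype.ext (Filter.Germ.coe_eq.mpr ?_)⟩
    rcases hf.eventually_eq_zero_or_eventually_ne_zero hM with h0 | h0
    · exact absurd (Subtype.ext (Filter.Germ.coe_eq.mpr h0)) h
    · exact h0.mono fun z hz => mul_inv_cancel₀ hz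

noncomputable instance : Field puiseuxSubring := isField_puiseuxSubring.toField

/-- The constant Puiseux germs. -/
def puiseuxConst : ℂ →+* puiseuxSubring :=
  ((Filter.Germ.coeRingHom imInfty).comp (Pi.constRingHom ℂ ℂ)).codRestrict puiseuxSubring
    fun c => ⟨fun _ => c, ⟨1, one_pos, .const c⟩, rfl⟩

instance : CharZero puiseuxSubring :=
  charZero_of_injective_ringHom puiseuxConst.injective

theorem eventually_map_evalRingHom_eq_zero {E : Polynomial (ℂ → ℂ)}
    (hE : E.map (Filter.Germ.coeRingHom imInfty) = 0) :
    ∀ᶠ z in imInfty, E.map (Pi.evalRingHom (fun _ => ℂ) z) = 0 := by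
  have h : ∀ᶠ z in imInfty, ∀ i ∈ E.support, E.coeff i z = 0 := by
    rw [Filter.eventually_all_finset]
    intro i _
    have h1 := congrArg (fun Q => Q.coeff i) hE
    simp only [Polynomial.coeff_map, Polynomial.coeff_zero] at h1
    exact Filter.Germ.coe_eq.mp h1
  filter_upwards [h] with z hz
  ext i
  rw [Polynomial.coeff_map, Polynomial.coeff_zero]
  by_cases hi : i ∈ E.support
  · exact hz i hi
  · rw [Polynomial.notMem_support_iff.mp hi, map_zero]

instance : IsAlgClosed puiseuxSubring := by
  refine IsAlgClosed.of_exists_root _ fun p hpm hpi => ?_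
  have hlift : ∀ Q : Polynomial (Filter.Germ imInfty ℂ),
      Q ∈ Polynomial.lifts (Filter.Germ.coeRingHom imInfty) := fun Q => by
    rw [Polynomial.lifts_iff_coeff_lifts]
    exact fun i => Quot.exists_rep (Q.coeff i)
  obtain ⟨P, hP, hPd, hPm⟩ := Polynomial.lifts_and_natDegree_eq_and_monic
    (hlift (p.map puiseuxSubring.subtype)) (hpm.map _)
  obtain ⟨a, b, hab⟩ := hpi.separable
  obtain ⟨A, hA⟩ := (Polynomial.mem_lifts _).mp (hlift (a.map puiseuxSubring.subtype))
  obtain ⟨B, hB⟩ := (Polynomial.mem_lifts _).mp (hlift (b.map puiseuxSubring.subtype))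
  have hbez := eventually_map_evalRingHom_eq_zero (E := A * P + B * Polynomial.derivative P - 1) (by
    have h1 := congrArg (Polynomial.map puiseuxSubring.subtype) hab
    simp only [Polynomial.map_add, Polynomial.map_mul, Polynomial.map_one,
      ← Polynomial.derivative_map, ← hA, ← hB, ← hP] at h1
    simp only [Polynomial.map_add, Polynomial.map_mul, Polynomial.map_one, Polynomial.map_sub,
      ← Polynomial.derivative_map, h1, sub_self])
  have hN : P.natDegree ≠ 0 := by
    rw [hPd, hpm.natDegree_map]
    exact hpi.natDegree_pos.ne'
  obtain ⟨f, hf, hfr⟩ := exists_isPuiseuxWith_root hN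
    (P := fun z => P.map (Pi.evalRingHom (fun _ => ℂ) z)) (fun z => hPm.map _)
    (fun z => hPm.natDegree_map _) (fun i => by
      obtain ⟨g, ⟨M, hM, hg⟩, hgi⟩ := (p.coeff i).2
      refine ⟨M, hM, hg.congr ?_⟩
      have h1 := congrArg (fun Q => Q.coeff i) hP
      simp only [Polynomial.coeff_map, Subring.subtype_apply, ← hgi] at h1
      simp only [Polynomial.coeff_map]
      exact Filter.Germ.coe_eq.mp h1)
    (by
      filter_upwards [hbez] with z hz x hx hx'
      have h1 := congrArg (Polynomial.eval x) hz
      simp only [Polynomial.map_add, Polynomial.map_mul, Polynomial.map_one, Polynomial.map_sub,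
        ← Polynomial.derivative_map, Polynomial.eval_sub, Polynomial.eval_add, Polynomial.eval_mul,
        hx, hx'] at h1
      simp at h1)
  refine ⟨⟨_, f, hf, rfl⟩, Subtype.ext ?_⟩
  have h1 : puiseuxSubring.subtype (p.eval ⟨_, f, hf, rfl⟩) =
      Filter.Germ.coeRingHom imInfty (P.eval f) := by
    rw [← Polynomial.eval_map_apply, ← Polynomial.eval_map_apply, hP]
    rfl
  refine h1.trans (Filter.Germ.coe_eq.mpr ?_)
  filter_upwards [hfr] with z hz
  exact (Polynomial.eval_map_apply (Pi.evalRingHom (fun _ => ℂ) z) f).symm.trans hz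

/-- The Puiseux germs that have a finite limit at `i∞`. -/
def puiseuxIntegers : ValuationSubring puiseuxSubring where
  carrier := {g | ∃ c : ℂ, (g : Filter.Germ imInfty ℂ).Tendsto (nhds c)}
  mul_mem' := by
    rintro ⟨_, f, hf, rfl⟩ ⟨_, g, hg, rfl⟩ ⟨c, hc⟩ ⟨c', hc'⟩
    exact ⟨c * c', Filter.Tendsto.mul (f := f) (g := g) hc hc'⟩
  add_mem' := by
    rintro ⟨_, f, hf, rfl⟩ ⟨_, g, hg, rfl⟩ ⟨c, hc⟩ ⟨c', hc'⟩
    exact ⟨c + c', Filter.Tendsto.add (f := f) (g := g) hc hc'⟩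
  one_mem' := ⟨1, tendsto_const_nhds (x := (1 : ℂ)) (f := imInfty)⟩
  zero_mem' := ⟨0, tendsto_const_nhds (x := (0 : ℂ)) (f := imInfty)⟩
  neg_mem' := by
    rintro ⟨_, f, hf, rfl⟩ ⟨c, hc⟩
    exact ⟨-c, Filter.Tendsto.neg (f := f) hc⟩
  mem_or_inv_mem' := by
    rintro ⟨_, f, ⟨M, hM, hf⟩, rfl⟩
    rcases hf.exists_tendsto_or_inv hM with ⟨c, hc⟩ | h
    · exact .inl ⟨c, hc⟩
    · rcases hf.eventually_eq_zero_or_eventually_ne_zero hM with h0 | h0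
      · exact .inl ⟨0, (tendsto_const_nhds (x := (0 : ℂ))).congr' (h0.mono fun z hz => hz.symm)⟩
      · refine .inr ⟨0, ?_⟩
        have h1 : (⟨_, f, ⟨M, hM, hf⟩, rfl⟩ : puiseuxSubring)⁻¹ =
            ⟨_, fun z => (f z)⁻¹, ⟨M, hM, hf.inv⟩, rfl⟩ :=
          inv_eq_of_mul_eq_one_right (Subtype.ext (Filter.Germ.coe_eq.mpr
            (h0.mono fun z hz => mul_inv_cancel₀ hz)))
        rw [h1]
        exact h

theorem exists_tendsto_of_mem_puiseuxIntegers (x : puiseuxIntegers) :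
    ∃ c : ℂ, ((x : puiseuxSubring) : Filter.Germ imInfty ℂ).Tendsto (nhds c) := x.2

theorem germ_tendsto_unique {g : Filter.Germ imInfty ℂ} {a b : ℂ} (ha : g.Tendsto (nhds a))
    (hb : g.Tendsto (nhds b)) : a = b := by
  induction g using Filter.Germ.inductionOn with
  | _ f => exact tendsto_nhds_unique (f := f) ha hb

/-- The limit at `i∞`. -/
noncomputable def puiseuxEval : puiseuxIntegers.toSubring →+* ℂ where
  toFun x := (exists_tendsto_of_mem_puiseuxIntegers x).choose
  map_one' := germ_tendsto_unique (exists_tendsto_of_mem_puiseuxIntegers 1).choose_spec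
    (tendsto_const_nhds (x := (1 : ℂ)) (f := imInfty))
  map_zero' := germ_tendsto_unique (exists_tendsto_of_mem_puiseuxIntegers 0).choose_spec
    (tendsto_const_nhds (x := (0 : ℂ)) (f := imInfty))
  map_mul' := by
    intro x y
    refine germ_tendsto_unique (exists_tendsto_of_mem_puiseuxIntegers (x * y)).choose_spec ?_
    have hx := (exists_tendsto_of_mem_puiseuxIntegers x).choose_spec
    have hy := (exists_tendsto_of_mem_puiseuxIntegers y).choose_spec
    obtain ⟨⟨_, f, hf, rfl⟩, hx'⟩ := x
    obtain ⟨⟨_, g, hg, rfl⟩, hy'⟩ := y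
    exact Filter.Tendsto.mul (f := f) (g := g) hx hy
  map_add' := by
    intro x y
    refine germ_tendsto_unique (exists_tendsto_of_mem_puiseuxIntegers (x + y)).choose_spec ?_
    have hx := (exists_tendsto_of_mem_puiseuxIntegers x).choose_spec
    have hy := (exists_tendsto_of_mem_puiseuxIntegers y).choose_spec
    obtain ⟨⟨_, f, hf, rfl⟩, hx'⟩ := x
    obtain ⟨⟨_, g, hg, rfl⟩, hy'⟩ := y
    exact Filter.Tendsto.add (f := f) (g := g) hx hy

theorem puiseuxEval_eq {x : puiseuxIntegers.toSubring} {c : ℂ}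
    (h : ((x : puiseuxSubring) : Filter.Germ imInfty ℂ).Tendsto (nhds c)) : puiseuxEval x = c :=
  germ_tendsto_unique (exists_tendsto_of_mem_puiseuxIntegers x).choose_spec h

theorem exists_rep_puiseuxIntegers (x : puiseuxIntegers.toSubring) :
    ∃ f : ℂ → ℂ, (∃ M, 0 < M ∧ IsPuiseuxWith M f) ∧
      (f : Filter.Germ imInfty ℂ) = ((x : puiseuxSubring) : Filter.Germ imInfty ℂ) ∧
      Filter.Tendsto f imInfty (nhds (puiseuxEval x)) := by
  have hx : ((x : puiseuxSubring) : Filter.Germ imInfty ℂ).Tendsto (nhds (puiseuxEval x)) :=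
    (exists_tendsto_of_mem_puiseuxIntegers x).choose_spec
  obtain ⟨f, hf, hfx⟩ := (x : puiseuxSubring).2
  rw [← hfx] at hx
  exact ⟨f, hf, hfx, hx⟩

/-- The constants as Puiseux germs with a finite limit. -/
noncomputable def puiseuxIntegersConst : ℂ →+* puiseuxIntegers.toSubring :=
  puiseuxConst.codRestrict puiseuxIntegers.toSubring
    fun c => ⟨c, tendsto_const_nhds (x := c) (f := imInfty)⟩

/-- The germ of `exp (2πiz)`. -/
noncomputable def puiseuxQ : puiseuxIntegers.toSubring :=
  ⟨⟨_, Function.Periodic.qParam (1 : ℕ), ⟨1, one_pos, .qParam⟩, rfl⟩, 0,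
    (Function.Periodic.qParam_tendsto (by norm_num)).mono_right nhdsWithin_le_nhds⟩

theorem puiseuxEval_const (c : ℂ) : puiseuxEval (puiseuxIntegersConst c) = c :=
  puiseuxEval_eq (tendsto_const_nhds (x := c) (f := imInfty))

theorem puiseuxEval_q : puiseuxEval puiseuxQ = 0 :=
  puiseuxEval_eq (x := puiseuxQ) (Filter.Tendsto.mono_right
    (Function.Periodic.qParam_tendsto (h := (1 : ℕ)) (by norm_num)) nhdsWithin_le_nhds)

/-- The inclusion of the Puiseux germs with a finite limit into all germs. -/
noncomputable def puiseuxIntegersGerm : puiseuxIntegers.toSubring →+* Filter.Germ imInfty ℂ :=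
  puiseuxSubring.subtype.comp puiseuxIntegers.toSubring.subtype

theorem eval₂_puiseuxQ_ne_zero {p : Polynomial ℂ} (hp : p ≠ 0) :
    p.eval₂ puiseuxIntegersConst puiseuxQ ≠ 0 := by
  intro h
  have h1 := congrArg puiseuxIntegersGerm h
  rw [Polynomial.hom_eval₂, map_zero] at h1
  have h2 : p.eval₂ (puiseuxIntegersGerm.comp puiseuxIntegersConst)
      (puiseuxIntegersGerm puiseuxQ) = Filter.Germ.coeRingHom imInfty
        (p.eval₂ (Pi.constRingHom ℂ ℂ) (Function.Periodic.qParam (1 : ℕ))) := by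
    rw [Polynomial.hom_eval₂]; rfl
  rw [h2] at h1
  have h3 : ∀ᶠ z in imInfty, p.eval (Function.Periodic.qParam (1 : ℕ) z) = 0 := by
    filter_upwards [Filter.Germ.coe_eq.mp h1] with z hz
    have h4 := Polynomial.hom_eval₂ p (Pi.constRingHom ℂ ℂ) (Pi.evalRingHom (fun _ => ℂ) z)
      (Function.Periodic.qParam (1 : ℕ))
    exact (h4.symm.trans hz)
  have h5 := (eventually_qParam_iff (M := 1) one_pos (p := fun s => p.eval s = 0)).mp h3
  have h6 : {x | p.eval x = 0}.Finite := by
    refine (Multiset.finite_toSet p.roots).subset fun x hx => ?_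
    exact (Polynomial.mem_roots hp).mpr hx
  have h7 : {x | p.eval x = 0}ᶜ ∈ nhdsWithin (0 : ℂ) {0}ᶜ := by
    have h8 := (h6.sdiff (t := {0})).isClosed.isOpen_compl.mem_nhds (x := (0 : ℂ)) (by simp)
    filter_upwards [mem_nhdsWithin_of_mem_nhds h8, self_mem_nhdsWithin] with s hs hs0 hs1
    exact hs ⟨hs1, hs0⟩
  obtain ⟨s, hs, hs'⟩ := (h5.and h7).exists
  exact hs' hs

theorem isIntegrallyClosedIn_puiseuxIntegers :
    IsIntegrallyClosedIn puiseuxIntegers.toSubring puiseuxSubring :=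
  (isIntegrallyClosed_iff_isIntegrallyClosedIn (R := puiseuxIntegers) puiseuxSubring).mp
    inferInstance

/-- A homomorphism into an algebraically closed field extends along an integral extension. -/
theorem exists_ringHom_extension_of_isIntegral {A B K : Type} [CommRing A] [CommRing B]
    [Algebra A B] [Algebra.IsIntegral A B] [FaithfulSMul A B] [Field K] [IsAlgClosed K]
    (ψ : A →+* K) : ∃ φ : B →+* K, φ.comp (algebraMap A B) = ψ := by
  have : (RingHom.ker ψ).IsPrime := RingHom.ker_isPrime ψ
  obtain ⟨Q, -, hQ, hcomap⟩ := Ideal.exists_ideal_over_prime_of_isIntegral (S := B)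
    (RingHom.ker ψ) ⊥ (by
      rw [← RingHom.ker_eq_comap_bot,
        (RingHom.injective_iff_ker_eq_bot _).mp (FaithfulSMul.algebraMap_injective A B)]
      exact bot_le)
  have hker : RingHom.ker ψ = Q.comap (algebraMap A B) := hcomap.symm
  let P := Q.comap (algebraMap A B)
  let : Algebra (A ⧸ P) K :=
    (Ideal.Quotient.lift P ψ fun a ha => by
      rw [← RingHom.mem_ker, hker]; exact ha).toAlgebra
  have hinjB : Function.Injective (algebraMap (A ⧸ P) (B ⧸ Q)) :=
    Ideal.algebraMap_quotient_injective
  have hinjK : Function.Injective (algebraMap (A ⧸ P) K) :=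
    RingHom.lift_injective_of_ker_le_ideal _ _ hker.le
  have : Module.IsTorsionFree (A ⧸ P) (B ⧸ Q) :=
    Module.isTorsionFree_iff_algebraMap_injective.mpr hinjB
  have : Module.IsTorsionFree (A ⧸ P) K :=
    Module.isTorsionFree_iff_algebraMap_injective.mpr hinjK
  have : Algebra.IsIntegral (A ⧸ P) (B ⧸ Q) := inferInstance
  let L : B ⧸ Q →ₐ[A ⧸ P] K := IsAlgClosed.lift
  refine ⟨(L : B ⧸ Q →+* K).comp (Ideal.Quotient.mk Q), ?_⟩
  ext a
  have := L.commutes (Ideal.Quotient.mk P a)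
  exact this

/-- A monic polynomial over an integrally closed subring of an algebraically closed field whose
constant coefficient is killed by a homomorphism to a domain has a root killed by it. -/
theorem exists_root_of_coeff_zero_mem_ker {K F : Type} [Field K] [IsAlgClosed K] [CommRing F]
    [IsDomain F] (O : Subring K) [IsIntegrallyClosedIn O K] (ev : O →+* F)
    (P : Polynomial O) (hP : P.Monic) (h0 : ev (P.coeff 0) = 0) :
    ∃ η : O, P.eval η = 0 ∧ ev η = 0 := by
  have hsplit := IsAlgClosed.splits (P.map O.subtype)
  have hmem : ∀ a ∈ (P.map O.subtype).roots, a ∈ O := by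
    intro a ha
    have hint : IsIntegral O a := ⟨P, hP, by
      have := Polynomial.isRoot_of_mem_roots ha
      rwa [Polynomial.IsRoot, Polynomial.eval_map] at this⟩
    obtain ⟨b, rfl⟩ := IsIntegrallyClosedIn.isIntegral_iff.mp hint
    exact b.2
  obtain ⟨s, hs⟩ : ∃ s : Multiset O, s.map O.subtype = (P.map O.subtype).roots := by
    refine ⟨(P.map O.subtype).roots.attach.map fun a => ⟨a.1, hmem a.1 a.2⟩, ?_⟩
    rw [Multiset.map_map]
    exact Multiset.attach_map_val _
  have hprod : P = (s.map fun a => Polynomial.X - Polynomial.C a).prod := by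
    apply Polynomial.map_injective O.subtype Subtype.val_injective
    rw [hsplit.eq_prod_roots_of_monic (hP.map _), ← hs, Polynomial.map_multiset_prod,
      Multiset.map_map, Multiset.map_map]
    simp
  have hz : ((s.map fun a => -a).map ev).prod = 0 := by
    rw [← map_multiset_prod]
    rw [Polynomial.coeff_zero_eq_eval_zero, hprod, Polynomial.eval_multiset_prod,
      Multiset.map_map] at h0
    simpa using h0
  rw [Multiset.prod_eq_zero_iff] at hz
  simp only [Multiset.mem_map, exists_exists_and_eq_and] at hz
  obtain ⟨η, hη, hev⟩ := hz
  refine ⟨η, ?_, by simpa using hev⟩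
  rw [hprod, Polynomial.eval_multiset_prod, Multiset.map_map]
  apply Multiset.prod_eq_zero
  rw [Multiset.mem_map]
  exact ⟨η, hη, by simp⟩

/-- Given finitely many elements integral over `S`, some element killed by a point `pt` over
`b` separates `pt` from all other points over `b`. -/
theorem exists_separating_element {σ : Type} [Fintype σ] {S C : Type} [CommRing S] [CommRing C]
    [Algebra ℂ C] [Algebra S C] [Algebra.IsIntegral S C] (x : σ → C)
    (b : S →+* ℂ) (pt : C →ₐ[ℂ] ℂ) :
    ∃ y : C, pt y = 0 ∧ ∀ χ : C →ₐ[ℂ] ℂ, (χ : C →+* ℂ).comp (algebraMap S C) = b →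
      χ y = 0 → ∀ j, χ (x j) = pt (x j) := by
  classical
  choose P hP hroot using fun j => Algebra.IsIntegral.isIntegral (R := S) (x j)
  let Z : σ → Finset ℂ := fun j => ((P j).map b).roots.toFinset
  have hZ : ∀ (χ : C →ₐ[ℂ] ℂ), (χ : C →+* ℂ).comp (algebraMap S C) = b →
      ∀ j, χ (x j) ∈ Z j := by
    intro χ hχ j
    rw [Multiset.mem_toFinset, Polynomial.mem_roots ((hP j).map b).ne_zero, Polynomial.IsRoot,
      Polynomial.eval_map, ← hχ]
    have := congrArg χ (hroot j)
    rw [map_zero] at this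
    rw [← this]
    exact (Polynomial.hom_eval₂ (P j) (algebraMap S C) (χ : C →+* ℂ) (x j)).symm
  let h : σ → Polynomial ℂ := fun j => ∏ ζ ∈ (Z j).erase (pt (x j)),
    (Polynomial.C (pt (x j) - ζ)⁻¹ * (Polynomial.X - Polynomial.C ζ))
  have hval : ∀ (χ : C →ₐ[ℂ] ℂ), χ (1 - ∏ j, Polynomial.aeval (x j) (h j)) =
      1 - ∏ j, (h j).eval (χ (x j)) := by
    intro χ
    simp only [map_sub, map_one, map_prod, ← Polynomial.aeval_algHom_apply]
    simp
  refine ⟨1 - ∏ j, Polynomial.aeval (x j) (h j), ?_, ?_⟩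
  · rw [hval, sub_eq_zero, eq_comm]
    refine Finset.prod_eq_one fun j _ => ?_
    rw [Polynomial.eval_prod]
    refine Finset.prod_eq_one fun ζ hζ => ?_
    have : pt (x j) - ζ ≠ 0 := sub_ne_zero.mpr (Finset.ne_of_mem_erase hζ).symm
    simp [this]
  · intro χ hχ h0 j
    by_contra hne
    rw [hval] at h0
    have : (h j).eval (χ (x j)) = 0 := by
      rw [Polynomial.eval_prod]
      exact Finset.prod_eq_zero (Finset.mem_erase.mpr ⟨hne, hZ χ hχ j⟩) (by simp)
    rw [Finset.prod_eq_zero (Finset.mem_univ j) this] at h0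
    simp at h0

/-- A closed point of an affine complex variety is the centre of a point with values in an
integrally closed subring `O` of an algebraically closed field, avoiding a given hypersurface. -/
theorem exists_ringHom_centered_at {σ : Type} [Fintype σ] {C : Type} [CommRing C] [IsDomain C]
    [Algebra ℂ C] [Algebra.FiniteType ℂ C] (x : σ → C)
    (hx : Algebra.adjoin ℂ (Set.range x) = ⊤)
    (pt : C →ₐ[ℂ] ℂ) (t : C) (ht : t ≠ 0) {K : Type} [Field K] [IsAlgClosed K] (O : Subring K)
    [IsIntegrallyClosedIn O K] (ev : O →+* ℂ) (κ : ℂ →+* O) (hκ : ∀ c, ev (κ c) = c)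
    (q : O) (hq : ev q = 0) (htr : ∀ p : Polynomial ℂ, p ≠ 0 → p.eval₂ κ q ≠ 0) :
    ∃ φ : C →+* O, (∀ c, φ (algebraMap ℂ C c) = κ c) ∧ (∀ c, ev (φ c) = pt c) ∧ φ t ≠ 0 := by
  obtain ⟨r, g, hginj, hgint⟩ := exists_integral_inj_algHom_of_fg ℂ C
  let : Algebra (MvPolynomial (Fin r) ℂ) C := g.toRingHom.toAlgebra
  have : Algebra.IsIntegral (MvPolynomial (Fin r) ℂ) C := ⟨hgint⟩
  have : FaithfulSMul (MvPolynomial (Fin r) ℂ) C :=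
    (faithfulSMul_iff_algebraMap_injective _ _).mpr hginj
  obtain ⟨f, hf, s, hs⟩ : ∃ f : MvPolynomial (Fin r) ℂ, f ≠ 0 ∧ t ∣ g f :=
    (Algebra.IsIntegral.isIntegral (R := MvPolynomial (Fin r) ℂ) t).isAlgebraic.exists_nonzero_dvd
      (mem_nonZeroDivisors_of_ne_zero ht)
  obtain ⟨w, hw⟩ : ∃ w : Fin r → ℂ, MvPolynomial.eval w f ≠ 0 := by
    by_contra! h
    exact hf (MvPolynomial.funext fun w => by simpa using h w)
  let b : Fin r → ℂ := fun i => pt (g (MvPolynomial.X i))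
  let ρ : MvPolynomial (Fin r) ℂ →+* O :=
    MvPolynomial.eval₂Hom κ (fun i => κ (b i) + κ (w i - b i) * q)
  have hρb : ev.comp ρ = (pt : C →+* ℂ).comp (algebraMap _ C) := by
    apply MvPolynomial.ringHom_ext
    · intro c
      have : algebraMap (MvPolynomial (Fin r) ℂ) C (MvPolynomial.C c) = algebraMap ℂ C c :=
        g.commutes c
      simp [ρ, hκ, this]
    · intro i
      simp only [RingHom.comp_apply, ρ, MvPolynomial.coe_eval₂Hom, MvPolynomial.eval₂_X, map_add,
        map_mul, hκ, hq, mul_zero, add_zero]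
      rfl
  have hρf : ρ f ≠ 0 := by
    let F : Polynomial ℂ := MvPolynomial.aeval
      (fun i => Polynomial.C (b i) + Polynomial.C (w i - b i) * Polynomial.X) f
    have hF : F ≠ 0 := by
      intro h
      apply hw
      have h1 : (Polynomial.evalRingHom (1 : ℂ)).comp (MvPolynomial.aeval
          (fun i => Polynomial.C (b i) + Polynomial.C (w i - b i) * Polynomial.X) :
          MvPolynomial (Fin r) ℂ →ₐ[ℂ] Polynomial ℂ).toRingHom = MvPolynomial.eval w := by
        apply MvPolynomial.ringHom_ext
        · intro c; simp
        · intro i; simp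
      rw [← h1]
      change Polynomial.eval 1 F = 0
      rw [h, Polynomial.eval_zero]
    have h2 : ρ = (Polynomial.eval₂RingHom κ q).comp (MvPolynomial.aeval
          (fun i => Polynomial.C (b i) + Polynomial.C (w i - b i) * Polynomial.X) :
          MvPolynomial (Fin r) ℂ →ₐ[ℂ] Polynomial ℂ).toRingHom := by
      apply MvPolynomial.ringHom_ext
      · intro c; simp [ρ]
      · intro i; simp [ρ]
    rw [h2]
    exact htr F hF
  obtain ⟨y, hy0, hysep⟩ := exists_separating_element (S := MvPolynomial (Fin r) ℂ) x
    (ev.comp ρ) pt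
  have hyint := Algebra.IsIntegral.isIntegral (R := MvPolynomial (Fin r) ℂ) y
  obtain ⟨η, hη, hevη⟩ := exists_root_of_coeff_zero_mem_ker O ev
    ((minpoly (MvPolynomial (Fin r) ℂ) y).map ρ) ((minpoly.monic hyint).map ρ) (by
      rw [Polynomial.coeff_map]
      change (ev.comp ρ) _ = 0
      rw [hρb]
      have := congrArg pt (minpoly.aeval (MvPolynomial (Fin r) ℂ) y)
      rw [map_zero, Polynomial.aeval_def] at this
      have h3 := Polynomial.hom_eval₂ (minpoly (MvPolynomial (Fin r) ℂ) y)
        (algebraMap _ C) (pt : C →+* ℂ) y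
      rw [show (pt : C →+* ℂ) y = 0 from hy0, Polynomial.eval₂_at_zero] at h3
      rw [← h3]; exact this)
  rw [Polynomial.eval_map] at hη
  let e := minpoly.equivAdjoin hyint
  let ψ : Algebra.adjoin (MvPolynomial (Fin r) ℂ) {y} →+* K :=
    O.subtype.comp ((AdjoinRoot.lift ρ η hη).comp (e.symm : _ →+* _))
  have : Algebra.IsIntegral (Algebra.adjoin (MvPolynomial (Fin r) ℂ) {y}) C :=
    Algebra.IsIntegral.tower_top (MvPolynomial (Fin r) ℂ)
  obtain ⟨φ, hφ⟩ := exists_ringHom_extension_of_isIntegral (B := C) ψ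
  have hφS : ∀ a, φ (algebraMap (MvPolynomial (Fin r) ℂ) C a) = ρ a := by
    intro a
    have h1 := congrArg (fun h => h (algebraMap (MvPolynomial (Fin r) ℂ)
      (Algebra.adjoin (MvPolynomial (Fin r) ℂ) {y}) a)) hφ
    simp only [RingHom.comp_apply] at h1
    rw [← IsScalarTower.algebraMap_apply] at h1
    rw [h1]
    simp [ψ]
  have hφy : φ y = η := by
    have h1 := congrArg (fun h => h ⟨y, Algebra.self_mem_adjoin_singleton _ y⟩) hφ
    have h2 : e.symm ⟨y, Algebra.self_mem_adjoin_singleton _ y⟩ = AdjoinRoot.root _ := by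
      rw [AlgEquiv.symm_apply_eq]
      apply Subtype.ext
      simp [e, minpoly.coe_equivAdjoin]
    simp only [RingHom.comp_apply] at h1
    change φ y = _ at h1
    rw [h1]
    simp only [ψ, RingHom.comp_apply]
    erw [h2]
    simp
  have hφO : ∀ c, φ c ∈ O := by
    intro c
    obtain ⟨p, hp, hpc⟩ := Algebra.IsIntegral.isIntegral (R := MvPolynomial (Fin r) ℂ) c
    have hint : IsIntegral O (φ c) := by
      refine ⟨p.map ρ, hp.map ρ, ?_⟩
      have := congrArg φ hpc
      rw [Polynomial.hom_eval₂, map_zero] at this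
      rw [Polynomial.eval₂_map, ← this]
      congr 1
      ext a
      · simp [hφS]; rfl
      · simp [hφS]; rfl
    obtain ⟨o, ho⟩ := IsIntegrallyClosedIn.isIntegral_iff.mp hint
    rw [← ho]
    exact o.2
  let Φ : C →+* O := φ.codRestrict O hφO
  have hΦS : ∀ a, Φ (algebraMap (MvPolynomial (Fin r) ℂ) C a) = ρ a := fun a =>
    Subtype.ext (hφS a)
  have hΦc : ∀ c, Φ (algebraMap ℂ C c) = κ c := by
    intro c
    have := hΦS (MvPolynomial.C c)
    rw [show algebraMap (MvPolynomial (Fin r) ℂ) C (MvPolynomial.C c) = algebraMap ℂ C c from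
      g.commutes c] at this
    rw [this]
    simp [ρ]
  let χ : C →ₐ[ℂ] ℂ := { ev.comp Φ with
    commutes' := fun c => by
      change ev (Φ _) = _
      rw [hΦc, hκ]; rfl }
  have hχ : ∀ c, χ c = ev (Φ c) := fun _ => rfl
  have hχpt : χ = pt := by
    apply AlgHom.ext_of_adjoin_eq_top hx
    rintro _ ⟨j, rfl⟩
    refine hysep χ ?_ ?_ j
    · ext a
      · simp [hχ, hΦS]
      · simp [hχ, hΦS]
    · rw [hχ, show Φ y = η from Subtype.ext hφy, hevη]
  refine ⟨Φ, hΦc, fun c => by rw [← hχ, hχpt], ?_⟩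
  intro h
  apply hρf
  rw [← hΦS, show algebraMap (MvPolynomial (Fin r) ℂ) C f = g f from rfl, hs, map_mul, h, zero_mul]

/-- The ideal of polynomials vanishing along an ultrafilter. -/
def ultrafilterVanishingIdeal {σ : Type} (F : Ultrafilter (σ → ℂ)) :
    Ideal (MvPolynomial σ ℂ) where
  carrier := {f | ∀ᶠ x in (F : Filter (σ → ℂ)), MvPolynomial.eval x f = 0}
  add_mem' := fun ha hb => by
    filter_upwards [ha, hb] with x h1 h2
    rw [map_add, h1, h2, add_zero]
  zero_mem' := .of_forall fun x => map_zero _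
  smul_mem' := fun c f hf => by
    filter_upwards [hf] with x h
    rw [smul_eq_mul, map_mul, h, mul_zero]

theorem mem_ultrafilterVanishingIdeal {σ : Type} {F : Ultrafilter (σ → ℂ)}
    {f : MvPolynomial σ ℂ} : f ∈ ultrafilterVanishingIdeal F ↔
      ∀ᶠ x in (F : Filter (σ → ℂ)), MvPolynomial.eval x f = 0 := Iff.rfl

instance {σ : Type} (F : Ultrafilter (σ → ℂ)) : (ultrafilterVanishingIdeal F).IsPrime where
  ne_top' := by
    rw [Ideal.ne_top_iff_one, mem_ultrafilterVanishingIdeal]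
    simp [F.neBot.ne]
  mem_or_mem' := by
    intro a b h
    simp only [mem_ultrafilterVanishingIdeal, map_mul, mul_eq_zero] at h ⊢
    exact Ultrafilter.eventually_or.mp h

/-- Curve selection: polynomial relations valid along an ultrafilter converging to `p` are
satisfied by an analytic arc through `p`, not contained in a given coordinate hyperplane that the
ultrafilter avoids. -/
theorem exists_analyticAt_arc {σ : Type} [Fintype σ] (F : Ultrafilter (σ → ℂ)) {p : σ → ℂ}
    (hF : (F : Filter (σ → ℂ)) ≤ nhds p) {j₀ : σ} (hj₀ : ∀ᶠ x in (F : Filter (σ → ℂ)), x j₀ ≠ 0) :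
    ∃ G : σ → ℂ → ℂ, (∀ j, AnalyticAt ℂ (G j) 0 ∧ G j 0 = p j) ∧
      (∀ᶠ s in nhdsWithin 0 {0}ᶜ, G j₀ s ≠ 0) ∧
      ∀ᶠ s in nhdsWithin 0 {0}ᶜ, ∀ f : MvPolynomial σ ℂ,
        (∀ᶠ x in (F : Filter (σ → ℂ)), MvPolynomial.eval x f = 0) →
          MvPolynomial.eval (fun j => G j s) f = 0 := by
  classical
  let I := ultrafilterVanishingIdeal F
  let x : σ → MvPolynomial σ ℂ ⧸ I := fun j => Ideal.Quotient.mkₐ ℂ I (MvPolynomial.X j)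
  have hx : Algebra.adjoin ℂ (Set.range x) = ⊤ := by
    have h1 : Set.range x = Ideal.Quotient.mkₐ ℂ I '' Set.range MvPolynomial.X :=
      Set.range_comp (Ideal.Quotient.mkₐ ℂ I) MvPolynomial.X
    rw [h1, ← AlgHom.map_adjoin, MvPolynomial.adjoin_range_X, Algebra.map_top,
      AlgHom.range_eq_top]
    exact Ideal.Quotient.mkₐ_surjective ℂ I
  have hI : ∀ f ∈ I, MvPolynomial.aeval p f = 0 := by
    intro f hf
    have h1 : Filter.Tendsto (fun x => MvPolynomial.eval x f) F (nhds (MvPolynomial.eval p f)) :=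
      ((MvPolynomial.continuous_eval f).tendsto p).mono_left hF
    have h2 : Filter.Tendsto (fun x => MvPolynomial.eval x f) F (nhds 0) :=
      tendsto_const_nhds.congr' (Filter.EventuallyEq.symm hf)
    exact tendsto_nhds_unique h1 h2
  let pt : (MvPolynomial σ ℂ ⧸ I) →ₐ[ℂ] ℂ := Ideal.Quotient.liftₐ I (MvPolynomial.aeval p) hI
  have ht : x j₀ ≠ 0 := by
    intro h
    have h1 : MvPolynomial.X j₀ ∈ I := Ideal.Quotient.eq_zero_iff_mem.mp h
    obtain ⟨y, hy, hy'⟩ := (hj₀.and (mem_ultrafilterVanishingIdeal.mp h1)).exists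
    exact hy (by simpa using hy')
  have := isIntegrallyClosedIn_puiseuxIntegers
  obtain ⟨φ, hφc, hφe, hφt⟩ := exists_ringHom_centered_at x hx pt (x j₀) ht
    puiseuxIntegers.toSubring puiseuxEval puiseuxIntegersConst puiseuxEval_const puiseuxQ
    puiseuxEval_q fun p hp => eval₂_puiseuxQ_ne_zero hp
  choose g hg hgx hgt using fun j => exists_rep_puiseuxIntegers (φ (x j))
  obtain ⟨M, hM, hgM⟩ := exists_common_isPuiseuxWith hg
  have hpx : ∀ j, puiseuxEval (φ (x j)) = p j := fun j => by
    rw [hφe]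
    exact MvPolynomial.aeval_X p j
  choose G hGa hG0 hgG using fun j => (hgM j).exists_analyticAt_of_tendsto hM (hgt j)
  have hev : ∀ f : MvPolynomial σ ℂ,
      (Filter.Germ.coeRingHom imInfty fun z => MvPolynomial.eval (fun j => g j z) f) =
        puiseuxIntegersGerm (φ (Ideal.Quotient.mkₐ ℂ I f)) := by
    intro f
    induction f using MvPolynomial.induction_on with
    | C a =>
      have h1 : Ideal.Quotient.mkₐ ℂ I (MvPolynomial.C a) = algebraMap ℂ _ a := rfl
      rw [h1, hφc]
      simp only [MvPolynomial.eval_C]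
      rfl
    | add f₁ f₂ h₁ h₂ =>
      rw [map_add, map_add, map_add, ← h₁, ← h₂, ← map_add]
      congr 1
      ext z
      simp
    | mul_X f j h =>
      rw [map_mul, map_mul, map_mul, ← h]
      have h2 : puiseuxIntegersGerm (φ (Ideal.Quotient.mkₐ ℂ I (MvPolynomial.X j))) =
        Filter.Germ.coeRingHom imInfty (g j) := (hgx j).symm
      rw [h2, ← map_mul]
      congr 1
      ext z
      simp
  have hgG' : ∀ᶠ z in imInfty, ∀ j, g j z = G j (Function.Periodic.qParam M z) :=
    Filter.eventually_all.mpr hgG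
  refine ⟨G, fun j => ⟨hGa j, (hG0 j).trans (hpx j)⟩, ?_, ?_⟩
  · rw [← eventually_qParam_iff hM]
    rcases (hgM j₀).eventually_eq_zero_or_eventually_ne_zero hM with h | h
    · refine absurd (Subtype.ext (Subtype.ext ?_)) hφt
      exact (hgx j₀).symm.trans (Filter.Germ.coe_eq.mpr h)
    · filter_upwards [h, hgG'] with z hz hz'
      rwa [← hz' j₀]
  · obtain ⟨S, hS⟩ := IsNoetherian.noetherian I
    have h1 : ∀ᶠ s in nhdsWithin (0 : ℂ) {0}ᶜ, ∀ f ∈ S, MvPolynomial.eval (fun j => G j s) f = 0 := by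
      rw [Filter.eventually_all_finset]
      intro f hf
      rw [← eventually_qParam_iff hM]
      have hfI : f ∈ I := hS ▸ Submodule.subset_span hf
      have h2 : Ideal.Quotient.mkₐ ℂ I f = 0 := Ideal.Quotient.eq_zero_iff_mem.mpr hfI
      have h3 := hev f
      rw [h2, map_zero, map_zero] at h3
      filter_upwards [Filter.Germ.coe_eq.mp h3, hgG'] with z hz hz'
      simpa only [hz'] using hz
    filter_upwards [h1] with s hs f hf
    have h4 : I ≤ RingHom.ker (MvPolynomial.eval fun j => G j s) := by
      rw [← hS]
      exact Ideal.span_le.mpr hs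
    exact h4 hf

/-- An analytic function vanishing at `0` but not identically is `s ^ k` in a suitable local
coordinate. -/
theorem exists_analyticAt_comp_eq_pow {T : ℂ → ℂ} (hT : AnalyticAt ℂ T 0) (hT0 : T 0 = 0)
    (hne : ∀ᶠ s in nhdsWithin 0 {0}ᶜ, T s ≠ 0) :
    ∃ k : ℕ, 0 < k ∧ ∃ ψ : ℂ → ℂ, AnalyticAt ℂ ψ 0 ∧ ψ 0 = 0 ∧
      ∀ᶠ s in nhds 0, T (ψ s) = s ^ k := by
  obtain ⟨k, h, hh, hh0, hTh⟩ := hT.exists_eventuallyEq_pow_smul_nonzero_iff.mpr fun h0 => by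
    obtain ⟨s, hs, hs'⟩ := (hne.and (h0.filter_mono nhdsWithin_le_nhds)).exists
    exact hs hs'
  have hk : 0 < k := by
    refine Nat.pos_of_ne_zero fun hk => hh0 ?_
    have h1 := hTh.self_of_nhds
    rw [hT0, hk] at h1
    simpa using h1.symm
  obtain ⟨c, hc⟩ := IsAlgClosed.exists_pow_nat_eq (h 0) hk
  have hc0 : c ≠ 0 := by
    rintro rfl
    rw [zero_pow hk.ne'] at hc
    exact hh0 hc.symm
  let r : ℂ → ℂ := fun s => c * Complex.exp (Complex.log (h s / h 0) / k)
  have hr : AnalyticAt ℂ r 0 := by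
    refine analyticAt_const.mul (AnalyticAt.cexp (AnalyticAt.div ?_ analyticAt_const
      (by exact_mod_cast hk.ne')))
    refine (hh.div analyticAt_const hh0).clog ?_
    simp [div_self hh0]
  have hr0 : r 0 = c := by simp [r, div_self hh0]
  have hrk : ∀ᶠ s in nhds 0, r s ^ k = h s := by
    filter_upwards [hh.continuousAt.eventually_ne hh0] with s hs
    simp only [r]
    rw [mul_pow, hc, ← Complex.exp_nat_mul, mul_div_cancel₀ _ (by exact_mod_cast hk.ne'),
      Complex.exp_log (div_ne_zero hs hh0), mul_div_cancel₀ _ hh0]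
  have hg : AnalyticAt ℂ (fun s => s * r s) 0 := analyticAt_id.mul hr
  have hg' : deriv (fun s => s * r s) 0 ≠ 0 := by
    have h1 : HasDerivAt (fun s => s * r s) (1 * r 0 + 0 * deriv r 0) 0 :=
      (hasDerivAt_id (0 : ℂ)).mul hr.differentiableAt.hasDerivAt
    rw [h1.deriv, hr0]
    simpa using hc0
  have hψ := hg.analyticAt_localInverse hg'
  have hinv := hg.hasStrictDerivAt.eventually_right_inverse hg'
  have hψ0 := HasStrictFDerivAt.localInverse_apply_image
    (hg.hasStrictDerivAt.hasStrictFDerivAt_equiv hg')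
  simp only [zero_mul] at hψ hinv hψ0
  refine ⟨k, hk, _, hψ, hψ0, ?_⟩
  have hcont := hψ.continuousAt.tendsto
  have hψ0' : hg.hasStrictDerivAt.localInverse (fun s => s * r s) _ 0 hg' 0 = 0 := hψ0
  rw [hψ0'] at hcont
  filter_upwards [hinv, hcont.eventually hTh, hcont.eventually hrk] with s h1 h2 h3
  rw [h2, sub_zero, smul_eq_mul, ← h3, ← mul_pow, h1]

/-- The gluing equation of `v` after the substitution `zᵢ = t ^ dᵢ uᵢ`, with denominators
cleared; `t` is the variable `none`, `uᵢ` is the variable `some i`. -/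
noncomputable def gluePolynomial (n : ℕ) (d : Fin n → ℕ) (v : GlueVec n) :
    MvPolynomial (Option (Fin n)) ℂ :=
  (∏ i, MvPolynomial.X (some i) ^ (v.1 i).toNat) *
      (∏ i, (1 - MvPolynomial.X none ^ d i * MvPolynomial.X (some i)) ^ (v.2.1 i).toNat) -
    MvPolynomial.C ((-1) ^ v.2.2) * ((∏ i, MvPolynomial.X (some i) ^ (-v.1 i).toNat) *
      (∏ i, (1 - MvPolynomial.X none ^ d i * MvPolynomial.X (some i)) ^ (-v.2.1 i).toNat))

theorem prod_zpow_eq_div {ι : Type} [Fintype ι] {x : ι → ℂ} (hx : ∀ i, x i ≠ 0) (a : ι → ℤ) :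
    ∏ i, x i ^ a i = (∏ i, x i ^ (a i).toNat) / ∏ i, x i ^ (-a i).toNat := by
  rw [← Finset.prod_div_distrib]
  refine Finset.prod_congr rfl fun i _ => ?_
  conv_lhs => rw [← Int.toNat_sub_toNat_neg (a i)]
  rw [zpow_sub₀ (hx i), zpow_natCast, zpow_natCast]

theorem eval_gluePolynomial_eq_zero_iff {n : ℕ} {d : Fin n → ℕ} {v : GlueVec n}
    (hv : ∑ i, v.1 i * (d i : ℤ) = 0) {x : Option (Fin n) → ℂ} (ht : x none ≠ 0)
    (hu : ∀ i, x (some i) ≠ 0) (hu1 : ∀ i, x none ^ d i * x (some i) ≠ 1) :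
    MvPolynomial.eval x (gluePolynomial n d v) = 0 ↔
      (∏ i, (x none ^ d i * x (some i)) ^ v.1 i) * (∏ i, (1 - x none ^ d i * x (some i)) ^ v.2.1 i)
        = (-1 : ℂ) ^ v.2.2 := by
  have h1 : ∏ i, (x none ^ d i * x (some i)) ^ v.1 i = ∏ i, x (some i) ^ v.1 i := by
    have h2 : ∀ s : Finset (Fin n),
        ∏ i ∈ s, (x none ^ d i) ^ v.1 i = x none ^ ∑ i ∈ s, v.1 i * (d i : ℤ) := by
      intro s
      induction s using Finset.induction_on with
      | empty => simp
      | insert i s hi ih =>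
        rw [Finset.prod_insert hi, Finset.sum_insert hi, ih, zpow_add₀ ht, ← zpow_natCast,
          ← zpow_mul, mul_comm (v.1 i)]
    simp only [mul_zpow]
    rw [Finset.prod_mul_distrib, h2, hv, zpow_zero, one_mul]
  have h3 : ∀ i, 1 - x none ^ d i * x (some i) ≠ 0 := fun i => sub_ne_zero.mpr (hu1 i).symm
  rw [h1, prod_zpow_eq_div hu, prod_zpow_eq_div h3, div_mul_div_comm, div_eq_iff]
  · simp [gluePolynomial, sub_eq_zero]
  · exact mul_ne_zero (Finset.prod_ne_zero_iff.mpr fun i _ => pow_ne_zero _ (hu i))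
      (Finset.prod_ne_zero_iff.mpr fun i _ => pow_ne_zero _ (h3 i))

/-- Second half of Lemma 4.4: if `W̄₀(Λ,d)` is nonempty for a degeneration vector `d`,
then some positive integer multiple of `d` is genuine. -/
theorem WbarZero_nonempty_implies_multiple_genuine (n : ℕ) (hn : 1 ≤ n)
    (Λ : Submodule ℤ (GlueVec n)) (d : Fin n → ℕ) (hd : IsDegVec n Λ d)
    (hne : (WbarZero n Λ d).Nonempty) :
    ∃ m : ℕ, 0 < m ∧ IsGenuine n Λ (fun i => m * d i) := by
  obtain ⟨p, ⟨hpc, hpu, hp1⟩, hp0⟩ := hne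
  replace hp0 : p.1 = 0 := hp0
  obtain ⟨F, hFW, hFp⟩ := mem_closure_iff_ultrafilter.mp hpc
  let e : ℂ × (Fin n → ℂ) → Option (Fin n) → ℂ := fun q o => o.elim q.1 q.2
  have he : Continuous e := continuous_pi fun o => by
    cases o with
    | none => exact continuous_fst
    | some i => exact (continuous_apply i).comp continuous_snd
  have hFW' : ∀ᶠ q in (F : Filter (ℂ × (Fin n → ℂ))), q ∈ Wset n Λ d := hFW
  obtain ⟨G, hG, hGt, hGrel⟩ := exists_analyticAt_arc (F.map e) (p := e p)
    ((he.tendsto p).mono_left hFp) (j₀ := none) (hFW'.mono fun q hq => hq.2.1)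
  have hrel : ∀ v ∈ Λ, ∀ᶠ x in (F.map e : Filter (Option (Fin n) → ℂ)),
      MvPolynomial.eval x (gluePolynomial n d v) = 0 := fun v hv =>
    hFW'.mono fun q hq => (eval_gluePolynomial_eq_zero_iff (x := e q) (hd.2 v hv) hq.2.1
      hq.1.1 hq.1.2).mpr (hq.2.2.2 v hv)
  have hG0 : G none 0 = 0 := (hG none).2.trans hp0
  obtain ⟨k, hk, ψ, hψ, hψ0, hψT⟩ := exists_analyticAt_comp_eq_pow (hG none).1 hG0 hGt
  have hψc : Filter.Tendsto ψ (nhds 0) (nhds 0) := by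
    simpa only [hψ0] using hψ.continuousAt.tendsto
  have hu : ∀ᶠ s in nhds 0, ∀ i, G (some i) s ≠ 0 :=
    Filter.eventually_all.mpr fun i => (hG (some i)).1.continuousAt.eventually_ne
      ((hG (some i)).2.trans_ne (hpu i))
  have hu1 : ∀ᶠ s in nhds 0, ∀ i, G none s ^ d i * G (some i) s ≠ 1 :=
    Filter.eventually_all.mpr fun i => by
      refine (((hG none).1.continuousAt.pow (d i)).mul
        (hG (some i)).1.continuousAt).eventually_ne ?_
      simp only [Pi.mul_apply, Pi.pow_apply]
      rw [(hG none).2, (hG (some i)).2]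
      exact hp1 i
  have hua : ∀ i, AnalyticAt ℂ (fun s => G (some i) (ψ s)) 0 := fun i =>
    AnalyticAt.fun_comp (by rw [hψ0]; exact (hG (some i)).1) hψ
  have hloc : ∀ᶠ s in nhds 0, (∀ i, DifferentiableAt ℂ (fun s => G (some i) (ψ s)) s) ∧
      (s ≠ 0 → (fun i => s ^ (k * d i) * G (some i) (ψ s)) ∈ glueVariety n Λ) := by
    have h1 : ∀ᶠ s in nhds 0, ∀ i, DifferentiableAt ℂ (fun s => G (some i) (ψ s)) s :=
      Filter.eventually_all.mpr fun i =>
        (hua i).eventually_analyticAt.mono fun s hs => hs.differentiableAt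
    filter_upwards [h1, hψT, hψc.eventually hu, hψc.eventually hu1,
      hψc.eventually (eventually_nhdsWithin_iff.mp hGrel)] with s hs hsT hsu hsu1 hsrel
    refine ⟨hs, fun hs0 => ?_⟩
    have hT : G none (ψ s) ≠ 0 := by
      rw [hsT]
      exact pow_ne_zero _ hs0
    have hψs : ψ s ≠ 0 := fun h => hT (by rw [h, hG0])
    simp only [pow_mul, ← hsT]
    exact ⟨fun i => ⟨mul_ne_zero (pow_ne_zero _ hT) (hsu i), hsu1 i⟩, fun v hv =>
      (eval_gluePolynomial_eq_zero_iff (x := fun j => G j (ψ s)) (hd.2 v hv) hT hsu hsu1).mp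
        (hsrel hψs _ (hrel v hv))⟩
  obtain ⟨ε, hε, hball⟩ := Metric.eventually_nhds_iff.mp hloc
  have hval : ∀ i, G (some i) (ψ 0) = p.2 i := fun i => by
    rw [hψ0]
    exact (hG (some i)).2
  refine ⟨k, hk, ε, hε, fun i s => G (some i) (ψ s), fun i s hs => ?_, fun i => ?_, fun i hi => ?_,
    fun t ht htε => ?_⟩
  · exact ((hball hs).1 i).differentiableWithinAt
  · exact (hval i).trans_ne (hpu i)
  · have hdi : d i = 0 := (Nat.mul_eq_zero.mp hi).resolve_left hk.ne'
    have h1 := hp1 i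
    rw [hdi, pow_zero, one_mul] at h1
    exact (hval i).trans_ne h1
  · exact (hball (by simpa using htε)).2 (norm_pos_iff.mp ht)
end

section
/- Suppose d = (d₁,…,dₙ) is a nonzero vector of nonnegative integers, and there exist ε > 0 and holomorphic functions u₁,…,uₙ on the disc {t ∈ ℂ : |t| < ε} with uᵢ(0) ≠ 0 for every i and uᵢ(0) ≠ 1 whenever dᵢ = 0, such that for every t with 0 < |t| < ε the point (t^{d₁}u₁(t),…,t^{dₙ}uₙ(t)) lies in V(Λ). Then a₁d₁+⋯+aₙdₙ = 0 for every (a,b,c) ∈ Λ; that is, d is a degeneration vector for Λ. -/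
open scoped BigOperators

open Filter Topology in
/-- If `t ^ s * F t` is eventually a nonzero constant as `t → 0`, `t ≠ 0`, where `F` is continuous
at `0` with `F 0 ≠ 0`, then `s = 0`. -/
theorem zpow_exponent_eq_zero_of_mul_eventually_const {𝕜 : Type*} [NontriviallyNormedField 𝕜]
    {s : ℤ} {F : 𝕜 → 𝕜} {c : 𝕜} (hF : ContinuousAt F 0) (hF0 : F 0 ≠ 0) (hc : c ≠ 0)
    (h : ∀ᶠ t in 𝓝[≠] (0 : 𝕜), t ^ s * F t = c) : s = 0 := by
  have hFlim : Tendsto F (𝓝[≠] 0) (𝓝 (F 0)) := hF.tendsto.mono_left nhdsWithin_le_nhds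
  have hpow : ∀ m : ℕ, m ≠ 0 → Tendsto (fun t : 𝕜 => t ^ m) (𝓝[≠] 0) (𝓝 0) := fun m hm => by
    have hcont : ContinuousAt (fun t : 𝕜 => t ^ m) 0 := by fun_prop
    simpa [ContinuousAt, hm] using hcont.tendsto.mono_left (nhdsWithin_le_nhds (s := {0}ᶜ))
  by_contra hs
  obtain ⟨m, rfl | rfl⟩ := s.eq_nat_or_neg
  · have hlim := (hpow m (by simpa using hs)).mul hFlim
    rw [zero_mul] at hlim
    refine hc (tendsto_nhds_unique (tendsto_const_nhds.congr' ?_) hlim)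
    filter_upwards [h] with t ht
    simpa using ht.symm
  · have hlim := (hpow m (by simpa using hs)).mul_const c
    rw [zero_mul] at hlim
    refine hF0 (tendsto_nhds_unique (hFlim.congr' ?_) hlim)
    filter_upwards [h, self_mem_nhdsWithin] with t ht ht0
    have htm : t ^ m ≠ 0 := pow_ne_zero m ht0
    rw [← ht, zpow_neg, zpow_natCast, mul_inv_cancel_left₀ htm]

/-- If a nonzero vector `d` of nonnegative integers admits a holomorphic family
`(t^{d₁}u₁(t), …, t^{dₙ}uₙ(t))` of points of `V(Λ)` as in the definition of genuineness,
then `∑ aᵢ dᵢ = 0` for every `(a,b,c) ∈ Λ`, i.e. `d` is a degeneration vector for `Λ`. -/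
theorem genuine_implies_degVec (n : ℕ) (hn : 1 ≤ n) (Λ : Submodule ℤ (GlueVec n))
    (d : Fin n → ℕ) (hd0 : d ≠ 0) (hgen : IsGenuine n Λ d) :
    IsDegVec n Λ d := by
  obtain ⟨ε, hε, u, hu, hu0, hu1, hV⟩ := hgen
  refine ⟨hd0, fun v hv => ?_⟩
  have hcont : ∀ i, ContinuousAt (u i) 0 := fun i =>
    ((hu i).differentiableAt (Metric.ball_mem_nhds 0 hε)).continuousAt
  have hne : ∀ i, 1 - (0 : ℂ) ^ d i * u i 0 ≠ 0 := fun i => by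
    by_cases hi : d i = 0
    · simpa [hi, sub_eq_zero] using (hu1 i hi).symm
    · simp [hi]
  refine zpow_exponent_eq_zero_of_mul_eventually_const (c := (-1 : ℂ) ^ v.2.2)
    (F := fun t => (∏ i, u i t ^ v.1 i) * ∏ i, (1 - t ^ d i * u i t) ^ v.2.1 i) ?_ ?_ ?_ ?_
  · refine ContinuousAt.mul (tendsto_finsetProd _ fun i _ => ?_)
      (tendsto_finsetProd _ fun i _ => ?_)
    · exact (hcont i).zpow₀ _ (Or.inl (hu0 i))
    · exact (continuousAt_const.sub ((continuousAt_id.pow _).mul (hcont i))).zpow₀ _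
        (Or.inl (hne i))
  · exact mul_ne_zero (Finset.prod_ne_zero_iff.2 fun i _ => zpow_ne_zero _ (hu0 i))
      (Finset.prod_ne_zero_iff.2 fun i _ => zpow_ne_zero _ (hne i))
  · exact zpow_ne_zero _ (by norm_num)
  · filter_upwards [self_mem_nhdsWithin,
      mem_nhdsWithin_of_mem_nhds (Metric.ball_mem_nhds (0 : ℂ) hε)] with t ht0 htε
    have ht : t ≠ 0 := ht0
    rw [← (hV t (norm_pos_iff.2 ht) (by simpa using htε)).2 v hv, ← mul_assoc]
    congr 1
    have hsum : t ^ (∑ i, v.1 i * (d i : ℤ)) = ∏ i, t ^ (v.1 i * (d i : ℤ)) := by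
      induction (Finset.univ : Finset (Fin n)) using Finset.cons_induction with
      | empty => simp
      | cons j S hj ih => rw [Finset.sum_cons, Finset.prod_cons, zpow_add₀ ht, ih]
    rw [hsum, ← Finset.prod_mul_distrib]
    refine Finset.prod_congr rfl fun i _ => ?_
    rw [mul_zpow, mul_comm (v.1 i), zpow_mul, zpow_natCast]
end

section
/- Let n = 2 and let Λ ⊆ ℤ⁵ be the subgroup generated by (0,1, 1,−1, 1), so V(Λ) is the set of (z₁,z₂) ∈ (ℂ∖{0,1})² with z₂(1−z₁)(1−z₂)^{−1} = −1. Then V(Λ) = {(z₁,z₂) ∈ (ℂ∖{0,1})² : z₁z₂ = 1}, and in particular V(Λ) is nonempty. Moreover d = (1,0) is a degeneration vector for Λ which is not genuine (showing that total positivity of d is a necessary hypothesis in Kabaya's criterion, even though here the projection of Λ to the a-coordinates has rank n−1 = 1). -/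
open scoped BigOperators

/-- For a cyclic `Λ`, the variety `V(Λ)` is cut out by the equation of the generator. -/
theorem mem_glueVariety_span_singleton {n : ℕ} (g : GlueVec n) (z : Fin n → ℂ) :
    z ∈ glueVariety n (Submodule.span ℤ {g}) ↔ (∀ i, z i ≠ 0 ∧ z i ≠ 1) ∧
      (∏ i, z i ^ g.1 i) * (∏ i, (1 - z i) ^ g.2.1 i) = (-1 : ℂ) ^ g.2.2 := by
  refine and_congr_right fun _ => ⟨fun h => h g (Submodule.mem_span_singleton_self g), ?_⟩
  intro h v hv
  obtain ⟨k, rfl⟩ := Submodule.mem_span_singleton.mp hv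
  simp only [Prod.smul_fst, Prod.smul_snd, Pi.smul_apply, smul_eq_mul, mul_comm k, zpow_mul,
    Finset.prod_zpow, ← mul_zpow, h]

/-- For a cyclic `Λ`, the degeneration condition need only be checked on the generator. -/
theorem isDegVec_span_singleton {n : ℕ} (g : GlueVec n) {d : Fin n → ℕ} (hd : d ≠ 0)
    (h : ∑ i, g.1 i * (d i : ℤ) = 0) : IsDegVec n (Submodule.span ℤ {g}) d := by
  refine ⟨hd, fun v hv => ?_⟩
  obtain ⟨k, rfl⟩ := Submodule.mem_span_singleton.mp hv
  simp only [Prod.smul_fst, Pi.smul_apply, smul_eq_mul, mul_assoc, ← Finset.mul_sum, h, mul_zero]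

/-- The gluing variety generated by `(0,1; 1,-1; 1)` is the conic `z₁ z₂ = 1`. -/
theorem glueVariety_eq_conic :
    glueVariety 2 (Submodule.span ℤ {((![0, 1], ![1, -1], 1) : GlueVec 2)})
      = {z : Fin 2 → ℂ | (∀ i, z i ≠ 0 ∧ z i ≠ 1) ∧ z 0 * z 1 = 1} := by
  ext z
  rw [mem_glueVariety_span_singleton]
  refine and_congr_right fun hz => ?_
  have h1 : 1 - z 1 ≠ 0 := sub_ne_zero.mpr (hz 1).2.symm
  simp only [Fin.prod_univ_two, Matrix.cons_val_zero, Matrix.cons_val_one, zpow_zero, zpow_one,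
    one_mul, zpow_neg]
  rw [← mul_assoc, mul_inv_eq_iff_eq_mul₀ h1]
  constructor <;> intro h <;> linear_combination -h

/-- The span of a nonzero vector in a torsion-free module over a domain has rank one. -/
theorem finrank_span_singleton_of_ne_zero {R M : Type*} [CommRing R] [IsDomain R]
    [AddCommGroup M] [Module R M] [Module.IsTorsionFree R M] {x : M} (hx : x ≠ 0) :
    Module.finrank R (Submodule.span R {x}) = 1 := by
  rw [← (LinearEquiv.toSpanNonzeroSingleton R M x hx).finrank_eq, Module.finrank_self]

/-- No `f` continuous at `0` satisfies `t f(t) = 1` on a punctured disc about the origin. -/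
theorem not_forall_mul_eq_one_of_continuousAt {f : ℂ → ℂ} (hf : ContinuousAt f 0) {ε : ℝ}
    (hε : 0 < ε) : ¬ ∀ t : ℂ, 0 < ‖t‖ → ‖t‖ < ε → t * f t = 1 := by
  intro h
  have hlim : Filter.Tendsto (fun t : ℂ => t * f t) (nhdsWithin 0 {0}ᶜ) (nhds 0) := by
    have hc : ContinuousAt (fun t : ℂ => t * f t) 0 := continuousAt_id.mul hf
    simpa using hc.tendsto.mono_left nhdsWithin_le_nhds
  have hev : (fun t : ℂ => t * f t) =ᶠ[nhdsWithin 0 {0}ᶜ] fun _ => 1 := by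
    filter_upwards [self_mem_nhdsWithin,
      nhdsWithin_le_nhds (Metric.ball_mem_nhds (0 : ℂ) hε)] with t ht0 ht
    exact h t (norm_pos_iff.mpr ht0) (mem_ball_zero_iff.mp ht)
  exact zero_ne_one (tendsto_nhds_unique hlim (tendsto_const_nhds.congr' hev.symm))

/-- First example of Section 4.4: for `n = 2` and `Λ` generated by `(0,1; 1,-1; 1)`,
the variety `V(Λ)` is the nonempty plane conic `z₁ z₂ = 1`, and `d = (1,0)` is a
degeneration vector (the `a`-part of `Λ` having rank `n - 1 = 1`) which is not genuine:
total positivity is necessary in Kabaya's criterion. -/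
theorem example_total_positivity_needed :
    glueVariety 2 (Submodule.span ℤ {((![0, 1], ![1, -1], 1) : GlueVec 2)})
      = {z : Fin 2 → ℂ | (∀ i, z i ≠ 0 ∧ z i ≠ 1) ∧ z 0 * z 1 = 1} ∧
    (glueVariety 2 (Submodule.span ℤ {((![0, 1], ![1, -1], 1) : GlueVec 2)})).Nonempty ∧
    Module.finrank ℤ
      ((Submodule.span ℤ {((![0, 1], ![1, -1], 1) : GlueVec 2)}).map
        (LinearMap.fst ℤ (Fin 2 → ℤ) ((Fin 2 → ℤ) × ℤ))) = 1 ∧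
    IsDegVec 2 (Submodule.span ℤ {((![0, 1], ![1, -1], 1) : GlueVec 2)}) ![1, 0] ∧
    ¬ IsGenuine 2 (Submodule.span ℤ {((![0, 1], ![1, -1], 1) : GlueVec 2)}) ![1, 0] := by
  refine ⟨glueVariety_eq_conic, ?_, ?_, isDegVec_span_singleton _ ?_ ?_, ?_⟩
  · rw [glueVariety_eq_conic]
    refine ⟨![2, 2⁻¹], ?_, ?_⟩
    · rw [Fin.forall_fin_two]
      norm_num
    · norm_num
  · rw [Submodule.map_span, Set.image_singleton]
    exact finrank_span_singleton_of_ne_zero fun h => by simpa using congrFun h 1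
  · exact fun h => by simpa using congrFun h 0
  · simp
  · rintro ⟨ε, hε, u, hu, -, -, hV⟩
    have hc (i : Fin 2) : ContinuousAt (u i) 0 :=
      ((hu i).differentiableAt (Metric.ball_mem_nhds 0 hε)).continuousAt
    refine not_forall_mul_eq_one_of_continuousAt ((hc 0).mul (hc 1)) hε fun t h0 h1 => ?_
    have h := hV t h0 h1
    rw [glueVariety_eq_conic] at h
    simpa [mul_assoc] using h.2
end

section
/- Let n = 2 and let Λ ⊆ ℤ⁵ be the subgroup generated by (0,0, 1,1, −1), so V(Λ) is the set of (z₁,z₂) ∈ (ℂ∖{0,1})² with (1−z₁)(1−z₂) = −1. Then V(Λ) is nonempty, every nonzero vector of nonnegative integers is a degeneration vector for Λ, and the totally positive degeneration vector d = (1,2) is not genuine (showing that the maximal-rank hypothesis on the a-part of Λ is necessary in Kabaya's criterion). -/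
open scoped BigOperators

/-- `V(Λ)`, for `Λ` generated by `(0,0; 1,1; -1)`, is the conic `(1-z₁)(1-z₂) = -1`. -/
theorem mem_glueVariety_conic_iff (z : Fin 2 → ℂ) :
    z ∈ glueVariety 2 (Submodule.span ℤ {((![0, 0], ![1, 1], -1) : GlueVec 2)}) ↔
      (∀ i, z i ≠ 0 ∧ z i ≠ 1) ∧ (1 - z 0) * (1 - z 1) = -1 := by
  refine and_congr_right fun _ => ⟨fun h => ?_, fun h v hv => ?_⟩
  · simpa [Fin.prod_univ_two] using h _ (Submodule.mem_span_singleton_self _)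
  · obtain ⟨k, rfl⟩ := Submodule.mem_span_singleton.mp hv
    simp [Fin.prod_univ_two, ← mul_zpow, h, ← inv_zpow]

/-- Second example of Section 4.4: for `n = 2` and `Λ` generated by `(0,0; 1,1; -1)`,
the variety `V(Λ)` (the plane conic `(1-z₁)(1-z₂) = -1`) is nonempty, every nonzero
vector of nonnegative integers is a degeneration vector, yet the totally positive
degeneration vector `d = (1,2)` is not genuine: the maximal-rank hypothesis on the
`a`-part of `Λ` is necessary in Kabaya's criterion. -/
theorem example_rank_hypothesis_needed :
    (glueVariety 2 (Submodule.span ℤ {((![0, 0], ![1, 1], -1) : GlueVec 2)})).Nonempty ∧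
    (∀ d : Fin 2 → ℕ, d ≠ 0 →
      IsDegVec 2 (Submodule.span ℤ {((![0, 0], ![1, 1], -1) : GlueVec 2)}) d) ∧
    ¬ IsGenuine 2 (Submodule.span ℤ {((![0, 0], ![1, 1], -1) : GlueVec 2)}) ![1, 2] := by
  refine ⟨⟨![3, 1 / 2], ?_⟩, fun d hd => ⟨hd, fun v hv => ?_⟩, ?_⟩
  · rw [mem_glueVariety_conic_iff]
    refine ⟨fun i => ?_, ?_⟩
    · fin_cases i <;> norm_num
    · norm_num
  · obtain ⟨k, rfl⟩ := Submodule.mem_span_singleton.mp hv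
    simp [Fin.sum_univ_two]
  · rintro ⟨ε, hε, u, hu, -, -, h⟩
    have hc (i : Fin 2) : ContinuousAt (u i) 0 :=
      ((hu i).differentiableAt (Metric.ball_mem_nhds 0 hε)).continuousAt
    have hlim : ContinuousAt (fun t : ℂ => (1 - t * u 0 t) * (1 - t ^ 2 * u 1 t)) 0 :=
      (continuousAt_const.sub (continuousAt_id.mul (hc 0))).mul
        (continuousAt_const.sub ((continuousAt_id.pow 2).mul (hc 1)))
    have htends := hlim.tendsto.mono_left (nhdsWithin_le_nhds (s := {0}ᶜ))
    have heq : (fun t : ℂ => (1 - t * u 0 t) * (1 - t ^ 2 * u 1 t))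
        =ᶠ[nhdsWithin 0 {0}ᶜ] fun _ => -1 := by
      filter_upwards [self_mem_nhdsWithin,
        mem_nhdsWithin_of_mem_nhds (Metric.ball_mem_nhds (0 : ℂ) hε)] with t ht htε
      simpa using ((mem_glueVariety_conic_iff _).mp
        (h t (norm_pos_iff.mpr ht) (mem_ball_zero_iff.mp htε))).2
    have := tendsto_nhds_unique (htends.congr' heq) tendsto_const_nhds
    norm_num at this
end
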